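/- Let A be a unital, simple, separable C*-algebra with stable rank one, real rank zero and strict comparison, and let Ω be a compact subset of ℂ. Let (φₙ) be a sequence of unital *-homomorphisms from C(Ω, ℂ) to A, each with finite-dimensional range, which is Cauchy with respect to d_W: for every ε > 0 there exists N such that d_W(φₙ, φₘ) < ε for all n, m ≥ N. Then there exists a unital *-homomorphism φ : C(Ω, ℂ) → A such that d_W(φₙ, φ) → 0. -/

import Mathlib

open Filter Topology
open scoped ENNReal ComplexOrder

section Definitions

variable {A : Type*} [CStarAlgebra A]

/-- Cuntz subequivalence of elements of a C*-algebra: `a ≾ b` iff there is a sequence `rₙ`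
with `‖rₙ* b rₙ - a‖ → 0`. -/
def CuntzLE {B : Type*} [NonUnitalNormedRing B] [StarRing B] (a b : B) : Prop :=
  ∃ r : ℕ → B, Tendsto (fun n => ‖star (r n) * b * r n - a‖) atTop (nhds 0)

/-- A tracial state on a unital C*-algebra `A`: a linear functional `τ : A → ℂ` with `τ(1) = 1`,
`τ(a* a) ≥ 0` for all `a`, and `τ(ab) = τ(ba)` for all `a, b`. -/
def IsTracialState (τ : A →ₗ[ℂ] ℂ) : Prop :=
  τ 1 = 1 ∧ (∀ a : A, 0 ≤ τ (star a * a)) ∧ (∀ a b : A, τ (a * b) = τ (b * a))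

/-- Positivity in the matrix algebra `M_k(A)`: `a ≥ 0` iff `a = c* c` for some `c`. -/
def IsPosM {k : ℕ} (a : Matrix (Fin k) (Fin k) A) : Prop :=
  ∃ c : Matrix (Fin k) (Fin k) A, a = star c * c

/-- Cuntz subequivalence in the matrix algebra `M_k(A)`: `a ≾ b` iff there is a sequence `rₙ`
with `rₙ* b rₙ → a`. -/
def CuntzLEM {k : ℕ} (a b : Matrix (Fin k) (Fin k) A) : Prop :=
  ∃ r : ℕ → Matrix (Fin k) (Fin k) A,
    Tendsto (fun n => star (r n) * b * r n) atTop (nhds a)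

/-- `d_τ(a) = L` for a positive element `a` of `M_k(A)`:  `L = lim_m τ_k(a^{1/m})`, where
`τ_k([a_{ij}]) = Σᵢ τ(a_{ii})` and `a^{1/m}` is the (unique) positive `m`-th root of `a`
(given by the continuous functional calculus). -/
def DTauEq (τ : A →ₗ[ℂ] ℂ) {k : ℕ} (a : Matrix (Fin k) (Fin k) A) (L : ℝ) : Prop :=
  ∃ rt : ℕ → Matrix (Fin k) (Fin k) A,
    (∀ m : ℕ, IsPosM (rt m) ∧ (rt m) ^ (m + 1) = a) ∧
    Tendsto (fun m => ∑ i, τ ((rt m) i i)) atTop (nhds (L : ℂ))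

/-- `A` has strict comparison (of positive elements): for every `k ≥ 1` and all nonzero positive
`a, b ∈ M_k(A)`, if `d_τ(a) < d_τ(b)` for every tracial state `τ` of `A`, then `a ≾ b`. -/
def StrictComparison (A : Type*) [CStarAlgebra A] : Prop :=
  ∀ (k : ℕ), 1 ≤ k → ∀ a b : Matrix (Fin k) (Fin k) A,
    IsPosM a → IsPosM b → a ≠ 0 → b ≠ 0 →
    (∀ τ : A →ₗ[ℂ] ℂ, IsTracialState τ →
      ∃ La Lb : ℝ, DTauEq τ a La ∧ DTauEq τ b Lb ∧ La < Lb) →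
    CuntzLEM a b

/-- `O` is a relatively open subset of `Ω`. -/
def RelOpen (Ω O : Set ℂ) : Prop := ∃ U : Set ℂ, IsOpen U ∧ O = U ∩ Ω

/-- The function `f_O : ℂ → ℂ`, equal to `min 1 (dist z (Ω \ O))` (with the convention that the
distance to the empty set is `∞`); its restriction to `Ω` is supported exactly on `O`. -/
noncomputable def fOFun (Ω O : Set ℂ) : ℂ → ℂ :=
  fun z => (((min 1 (EMetric.infEdist z (Ω \ O))).toReal : ℝ) : ℂ)

lemma continuous_fOFun (Ω O : Set ℂ) : Continuous (fOFun Ω O) := by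
  apply Complex.continuous_ofReal.comp
  apply ENNReal.continuousOn_toReal.comp_continuous
    (continuous_const.min EMetric.continuous_infEdist)
  intro z
  exact ne_top_of_le_ne_top ENNReal.one_ne_top (min_le_left _ _)

/-- `f_O` as an element of `C(Ω, ℂ)`. -/
noncomputable def fO (Ω O : Set ℂ) : C(Ω, ℂ) :=
  ⟨fun z => fOFun Ω O z, (continuous_fOFun Ω O).comp continuous_subtype_val⟩

/-- `O_r = {x ∈ Ω | dist (x, O) < r}`. -/
def thicken (Ω O : Set ℂ) (r : ℝ) : Set ℂ := {x | x ∈ Ω ∧ Metric.infDist x O < r}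

/-- The Cuntz distance `d_W` between two maps `C(Ω, ℂ) → A`, with values in `[0, ∞]`
(the infimum of the empty set being `∞`). -/
noncomputable def dW (Ω : Set ℂ) (φ ψ : C(Ω, ℂ) → A) : ℝ≥0∞ :=
  sInf {e : ℝ≥0∞ | ∃ r : ℝ, 0 < r ∧ e = ENNReal.ofReal r ∧
    ∀ O : Set ℂ, RelOpen Ω O →
      CuntzLE (φ (fO Ω O)) (ψ (fO Ω (thicken Ω O r))) ∧
      CuntzLE (ψ (fO Ω O)) (φ (fO Ω (thicken Ω O r)))}

end Definitions

section Hall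

variable {G : Type*} [AddCommGroup G] (C : AddSubmonoid G)

/-- The refinement property of the positive cone `C` of a partially ordered abelian group. -/
def ConeRefinement : Prop :=
  ∀ a ∈ C, ∀ b ∈ C, ∀ c ∈ C, ∀ d ∈ C, a + b = c + d →
    ∃ z₁₁ ∈ C, ∃ z₁₂ ∈ C, ∃ z₂₁ ∈ C, ∃ z₂₂ ∈ C,
      a = z₁₁ + z₁₂ ∧ b = z₂₁ + z₂₂ ∧ c = z₁₁ + z₂₁ ∧ d = z₁₂ + z₂₂

variable {C}

lemma ConeRefinement.interpolate_two (h : ConeRefinement C) {a₁ a₂ b₁ b₂ : G}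
    (h₁₁ : b₁ - a₁ ∈ C) (h₁₂ : b₂ - a₁ ∈ C) (h₂₁ : b₁ - a₂ ∈ C) (h₂₂ : b₂ - a₂ ∈ C) :
    ∃ t, t - a₁ ∈ C ∧ t - a₂ ∈ C ∧ b₁ - t ∈ C ∧ b₂ - t ∈ C := by
  obtain ⟨d₁, hd₁, d₂, hd₂, d₃, hd₃, d₄, hd₄, e₁, e₂, e₃, e₄⟩ :=
    h _ h₁₁ _ h₂₂ _ h₁₂ _ h₂₁ (by abel)
  refine ⟨a₁ + d₁, by simpa using hd₁, ?_, ?_, ?_⟩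
  · have : a₁ + d₁ - a₂ = d₄ := by
      rw [sub_eq_iff_eq_add] at e₁ e₄
      have h1 : b₁ = d₁ + d₂ + a₁ := e₁
      rw [h1] at e₄
      have h2 : a₁ + d₁ + d₂ = d₄ + a₂ + d₂ := by
        calc a₁ + d₁ + d₂ = d₁ + d₂ + a₁ := by abel
          _ = d₂ + d₄ + a₂ := e₄
          _ = _ := by abel
      rw [sub_eq_iff_eq_add]
      exact add_right_cancel h2
    rw [this]; exact hd₄
  · have : b₁ - (a₁ + d₁) = d₂ := by rw [← sub_sub, e₁]; abel
    rw [this]; exact hd₂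
  · have : b₂ - (a₁ + d₁) = d₃ := by rw [← sub_sub, e₃]; abel
    rw [this]; exact hd₃

lemma ConeRefinement.interpolate (h : ConeRefinement C) {L U : Finset G} (hL : L.Nonempty)
    (hU : U.Nonempty) (hLU : ∀ a ∈ L, ∀ b ∈ U, b - a ∈ C) :
    ∃ t, (∀ a ∈ L, t - a ∈ C) ∧ ∀ b ∈ U, b - t ∈ C := by
  have key : ∀ (a₁ a₂ : G) (U : Finset G), U.Nonempty → (∀ b ∈ U, b - a₁ ∈ C) →
      (∀ b ∈ U, b - a₂ ∈ C) → ∃ t, t - a₁ ∈ C ∧ t - a₂ ∈ C ∧ ∀ b ∈ U, b - t ∈ C := by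
    intro a₁ a₂ U hU
    induction hU using Finset.Nonempty.cons_induction with
    | singleton b =>
      intro h₁ h₂
      exact ⟨b, h₁ b (by simp), h₂ b (by simp), by simp⟩
    | cons b s hb hs ih =>
      intro h₁ h₂
      obtain ⟨t, ht₁, ht₂, ht⟩ := ih (fun c hc => h₁ c (by simp [hc]))
        (fun c hc => h₂ c (by simp [hc]))
      obtain ⟨t', k₁, k₂, k₃, k₄⟩ := h.interpolate_two (h₁ b (by simp)) ht₁ (h₂ b (by simp)) ht₂
      refine ⟨t', k₁, k₂, fun c hc => ?_⟩
      rcases Finset.mem_cons.1 hc with rfl | hc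
      · exact k₃
      · have := C.add_mem (ht c hc) k₄
        rwa [sub_add_sub_cancel] at this
  induction hL using Finset.Nonempty.cons_induction with
  | singleton a => exact ⟨a, by simp, fun b hb => hLU a (by simp) b hb⟩
  | cons a s ha hs ih =>
    obtain ⟨t, ht₁, ht₂⟩ := ih (fun c hc => hLU c (by simp [hc]))
    obtain ⟨t', k₁, k₂, k₃⟩ := key a t U hU (hLU a (by simp)) ht₂
    refine ⟨t', fun c hc => ?_, k₃⟩
    rcases Finset.mem_cons.1 hc with rfl | hc
    · exact k₁
    · have := C.add_mem k₂ (ht₁ c hc)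
      rwa [sub_add_sub_cancel] at this

/-- A supply-demand (Hall type) theorem in abelian groups ordered by a cone with refinement:
supplies `x` can be shipped to demands `y` along the edges `E` iff every set of suppliers is
dominated by every set of consumers containing all its neighbours. -/
theorem ConeRefinement.hall (h : ConeRefinement C) (hcon : ∀ a ∈ C, -a ∈ C → a = 0)
    {I J : Type*} [Fintype I] [Fintype J] [DecidableEq I] [DecidableEq J]
    (E : Finset (I × J)) (x : I → G) (y : J → G) (hxy : ∑ i, x i = ∑ j, y j)
    (hE : ∀ (S : Finset I) (T : Finset J), (∀ e ∈ E, e.1 ∈ S → e.2 ∈ T) →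
      ∑ j ∈ T, y j - ∑ i ∈ S, x i ∈ C) :
    ∃ z : I → J → G, (∀ i j, z i j ∈ C) ∧ (∀ i j, (i, j) ∉ E → z i j = 0) ∧
      (∀ i, ∑ j, z i j = x i) ∧ (∀ j, ∑ i, z i j = y j) := by
  induction E using Finset.induction_on generalizing x y with
  | empty =>
    have hx : ∀ i, x i = 0 := by
      intro i
      refine hcon _ ?_ ?_
      · have := hE (Finset.univ.erase i) Finset.univ (by simp)
        rwa [← hxy, ← Finset.sum_erase_add _ _ (Finset.mem_univ i), add_sub_cancel_left] at this
      · simpa using hE {i} ∅ (by simp)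
    have hy : ∀ j, y j = 0 := by
      intro j
      refine hcon _ ?_ ?_
      · simpa using hE ∅ {j} (by simp)
      · have := hE Finset.univ (Finset.univ.erase j) (by simp)
        rwa [hxy, ← Finset.sum_erase_add _ _ (Finset.mem_univ j), sub_add_cancel_left] at this
    exact ⟨fun _ _ => 0, fun _ _ => C.zero_mem, fun _ _ _ => rfl, by simp [hx], by simp [hy]⟩
  | insert e E he ih =>
    obtain ⟨i₀, j₀⟩ := e
    classical
    let cl : Finset I × Finset J → Prop := fun p => ∀ e ∈ E, e.1 ∈ p.1 → e.2 ∈ p.2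
    let D : Finset I × Finset J → G := fun p => ∑ j ∈ p.2, y j - ∑ i ∈ p.1, x i
    let U : Finset G := (Finset.univ.filter fun p => cl p ∧ i₀ ∉ p.1 ∧ j₀ ∈ p.2).image D
    let L : Finset G := insert 0
      ((Finset.univ.filter fun p => cl p ∧ i₀ ∈ p.1 ∧ j₀ ∉ p.2).image fun p => - D p)
    have hD : ∀ p : Finset I × Finset J, cl p → (i₀ ∈ p.1 → j₀ ∈ p.2) → D p ∈ C := by
      intro p hp hp'
      refine hE _ _ fun e he => ?_
      rcases Finset.mem_insert.1 he with rfl | he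
      · exact hp'
      · exact hp e he
    have hsup : ∀ p q : Finset I × Finset J,
        D p + D q = D (p.1 ∪ q.1, p.2 ∪ q.2) + D (p.1 ∩ q.1, p.2 ∩ q.2) := by
      intro p q
      have h1 := Finset.sum_union_inter (s₁ := p.1) (s₂ := q.1) (f := x)
      have h2 := Finset.sum_union_inter (s₁ := p.2) (s₂ := q.2) (f := y)
      simp only [D]
      rw [sub_add_sub_comm, sub_add_sub_comm, h1, h2]
    obtain ⟨t, htL, htU⟩ := h.interpolate (L := L) (U := U) ⟨0, by simp [L]⟩
      ⟨D (∅, {j₀}), Finset.mem_image_of_mem _ (by simp [cl])⟩ (by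
        intro a ha b hb
        obtain ⟨q, hq, rfl⟩ := Finset.mem_image.1 hb
        simp only [Finset.mem_filter, Finset.mem_univ, true_and] at hq
        rcases Finset.mem_insert.1 ha with rfl | ha
        · rw [sub_zero]
          exact hD q hq.1 fun h => absurd h hq.2.1
        · obtain ⟨p, hp, rfl⟩ := Finset.mem_image.1 ha
          simp only [Finset.mem_filter, Finset.mem_univ, true_and] at hp
          rw [sub_neg_eq_add, hsup]
          refine C.add_mem (hD _ ?_ ?_) (hD _ ?_ ?_)
          · intro e he h
            rcases Finset.mem_union.1 h with h | h
            · exact Finset.mem_union_left _ (hq.1 e he h)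
            · exact Finset.mem_union_right _ (hp.1 e he h)
          · exact fun _ => Finset.mem_union_left _ hq.2.2
          · intro e he h
            rw [Finset.mem_inter] at h ⊢
            exact ⟨hq.1 e he h.1, hp.1 e he h.2⟩
          · exact fun h => absurd (Finset.mem_inter.1 h).1 hq.2.1)
    have ht0 : t ∈ C := by simpa using htL 0 (by simp [L])
    have hsx : ∀ S : Finset I, ∑ i ∈ S, (x - (Pi.single i₀ t : I → G)) i
        = ∑ i ∈ S, x i - if i₀ ∈ S then t else 0 := by
      intro S
      simp [Finset.sum_sub_distrib]
    have hsy : ∀ T : Finset J, ∑ j ∈ T, (y - (Pi.single j₀ t : J → G)) j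
        = ∑ j ∈ T, y j - if j₀ ∈ T then t else 0 := by
      intro T
      simp [Finset.sum_sub_distrib]
    obtain ⟨z, hz, hzE, hzx, hzy⟩ := ih (x - Pi.single i₀ t) (y - Pi.single j₀ t)
      (by rw [hsx, hsy, hxy]; simp) (by
        intro S T hST
        have hST' : cl (S, T) := hST
        rw [hsx, hsy]
        by_cases hi : i₀ ∈ S <;> by_cases hj : j₀ ∈ T
        · simpa [hi, hj] using hD (S, T) hST' fun _ => hj
        · have := htL (- D (S, T)) (Finset.mem_insert_of_mem
            (Finset.mem_image.2 ⟨(S, T), by simp [hST', hi, hj], rfl⟩))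
          simp only [hi, hj, if_true, if_false]
          convert this using 1
          simp only [D]; abel
        · have := htU (D (S, T)) (Finset.mem_image_of_mem _ (by simp [hST', hi, hj]))
          simp only [hi, hj, if_true, if_false]
          convert this using 1
          simp only [D]; abel
        · simpa [hi, hj] using hD (S, T) hST' fun h => absurd h hi)
    refine ⟨fun i j => z i j + if (i, j) = (i₀, j₀) then t else 0, fun i j => ?_, fun i j hij => ?_,
      fun i => ?_, fun j => ?_⟩
    · refine C.add_mem (hz i j) ?_
      split_ifs
      · exact ht0
      · exact C.zero_mem
    · rw [Finset.mem_insert, not_or] at hij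
      simp [hij.1, hzE i j hij.2]
    · rw [Finset.sum_add_distrib, hzx]
      by_cases hi : i = i₀
      · subst hi; simp
      · simp [hi]
    · rw [Finset.sum_add_distrib, hzy]
      by_cases hj : j = j₀
      · subst hj; simp
      · simp [hj]

end Hall

section FamEquiv

open Matrix

variable {A : Type*} [Ring A]

/-- Isomorphism of the modules `⨁ᵢ pᵢ A` and `⨁ⱼ qⱼ A` for finite families `p`, `q` of idempotents,
implemented by a pair of mutually inverse matrices. -/
def FamEquiv {ι κ : Type*} [Fintype ι] [Fintype κ] [DecidableEq ι] [DecidableEq κ]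
    (p : ι → A) (q : κ → A) : Prop :=
  ∃ (v : Matrix κ ι A) (w : Matrix ι κ A), w * v = diagonal p ∧ v * w = diagonal q ∧
    v * diagonal p = v ∧ w * diagonal q = w

variable {ι κ μ : Type*} [Fintype ι] [Fintype κ] [Fintype μ] [DecidableEq ι] [DecidableEq κ]
  [DecidableEq μ] {p : ι → A} {q : κ → A} {r : μ → A}

lemma FamEquiv.refl (hp : ∀ i, p i * p i = p i) : FamEquiv p p := by
  have : diagonal p * diagonal p = diagonal p := by simp [diagonal_mul_diagonal, hp]
  exact ⟨diagonal p, diagonal p, this, this, this, this⟩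

lemma FamEquiv.symm (h : FamEquiv p q) : FamEquiv q p := by
  obtain ⟨v, w, h₁, h₂, h₃, h₄⟩ := h
  exact ⟨w, v, h₂, h₁, h₄, h₃⟩

lemma FamEquiv.trans (h : FamEquiv p q) (h' : FamEquiv q r) : FamEquiv p r := by
  obtain ⟨v, w, h₁, h₂, h₃, h₄⟩ := h
  obtain ⟨v', w', h₁', h₂', h₃', h₄'⟩ := h'
  refine ⟨v' * v, w * w', ?_, ?_, ?_, ?_⟩
  · rw [Matrix.mul_assoc, ← Matrix.mul_assoc w', h₁', ← h₂, ← Matrix.mul_assoc, ← Matrix.mul_assoc,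
      h₁, Matrix.mul_assoc, h₁, ← h₁, Matrix.mul_assoc, ← Matrix.mul_assoc v, h₂,
      ← Matrix.mul_assoc, h₄]
  · rw [Matrix.mul_assoc, ← Matrix.mul_assoc v, h₂, ← Matrix.mul_assoc, h₃', h₂']
  · rw [Matrix.mul_assoc, h₃]
  · rw [Matrix.mul_assoc, h₄']

lemma FamEquiv.reindex (e : ι ≃ κ) (hp : ∀ i, p i * p i = p i) (hq : ∀ i, q (e i) = p i) :
    FamEquiv p q := by
  have hd : diagonal p * diagonal p = diagonal p := by simp [diagonal_mul_diagonal, hp]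
  have hq' : diagonal q = (diagonal p).submatrix e.symm e.symm := by
    rw [submatrix_diagonal_equiv]
    congr 1
    ext j
    simp [← hq]
  refine ⟨(diagonal p).submatrix e.symm id, (diagonal p).submatrix id e.symm, ?_, ?_, ?_, ?_⟩
  · rw [submatrix_mul_equiv, hd, submatrix_id_id]
  · rw [hq', ← submatrix_mul _ _ _ _ _ Function.bijective_id, hd]
  · have := submatrix_mul (diagonal p) (diagonal p) e.symm id id Function.bijective_id
    rw [submatrix_id_id, hd] at this
    exact this.symm
  · rw [hq', submatrix_mul_equiv, hd]

lemma FamEquiv.sum {ι' κ' : Type*} [Fintype ι'] [Fintype κ'] [DecidableEq ι'] [DecidableEq κ']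
    {p' : ι' → A} {q' : κ' → A} (h : FamEquiv p q) (h' : FamEquiv p' q') :
    FamEquiv (Sum.elim p p') (Sum.elim q q') := by
  obtain ⟨v, w, h₁, h₂, h₃, h₄⟩ := h
  obtain ⟨v', w', h₁', h₂', h₃', h₄'⟩ := h'
  refine ⟨fromBlocks v 0 0 v', fromBlocks w 0 0 w', ?_, ?_, ?_, ?_⟩ <;>
  simp [← fromBlocks_diagonal, fromBlocks_multiply, *]

end FamEquiv

section Cancellation

open Matrix

/-- In a Banach ring with dense invertibles, corners have Bass stable rank one. -/
lemma exists_corner_inverse {A : Type*} [NormedRing A] [CompleteSpace A]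
    (hsr1 : Dense {a : A | IsUnit a}) {r x a b : A} (hr : r * r = r)
    (hxr : x * r = x) (hra : r * a = a) (har : a * r = a)
    (hbr : b * r = b) (h : x * a + b = r) :
    ∃ y α, α * (a + y * b) = r ∧ (a + y * b) * α = r ∧ r * α = α ∧ r * y = y := by
  have hX : (x + (1 - r)) * (a + (1 - r)) + b = 1 := by
    have h1 : x * (1 - r) = 0 := by rw [mul_sub, hxr, mul_one, sub_self]
    have h2 : (1 - r) * a = 0 := by rw [sub_mul, hra, one_mul, sub_self]
    have h3 : (1 - r) * (1 - r) = 1 - r := by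
      rw [sub_mul, one_mul, mul_sub, hr, mul_one, sub_self, sub_zero]
    calc _ = x * a + b + x * (1 - r) + (1 - r) * a + (1 - r) * (1 - r) := by noncomm_ring
      _ = 1 := by rw [h1, h2, h3, h]; abel
  have hopen : ∀ᶠ X in 𝓝 (x + (1 - r)), IsUnit (X * (a + (1 - r)) + b) := by
    have hc : Continuous fun X : A => X * (a + (1 - r)) + b := by fun_prop
    have := hc.continuousAt (x := x + (1 - r))
    apply this.eventually
    simp only [hX]
    exact Units.isOpen.mem_nhds isUnit_one
  obtain ⟨X, hXu, hXX⟩ := (mem_closure_iff_frequently.1 (hsr1 (x + (1 - r)))).and_eventually hopen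
    |>.exists
  obtain ⟨X, rfl⟩ := hXu
  obtain ⟨g, hg⟩ : IsUnit (a + (1 - r) + ↑X⁻¹ * b) := by
    have : a + (1 - r) + ↑X⁻¹ * b = ↑X⁻¹ * (↑X * (a + (1 - r)) + b) := by
      rw [mul_add, ← mul_assoc, Units.inv_mul, one_mul]
    rw [this]
    exact (Units.isUnit _).mul hXX
  set c : A := ↑X⁻¹
  set n := (1 - r) * c * b with hn
  set α := a + r * c * b with hα
  have hrn : r * n = 0 := by
    rw [hn, ← mul_assoc, ← mul_assoc, mul_sub, hr]; simp
  have hnr : n * r = n := by rw [hn, mul_assoc, hbr]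
  have hαr : α * r = α := by rw [hα, add_mul, har, mul_assoc, hbr]
  have hrα : r * α = α := by rw [hα, mul_add, hra, ← mul_assoc, ← mul_assoc, hr]
  have hnn : n * n = 0 := by rw [← hnr, mul_assoc, ← mul_assoc r, hrn]; simp
  have hαn : α * n = 0 := by rw [← hαr, mul_assoc, hrn, mul_zero]
  have hw : a + (1 - r) + c * b = α + (1 - r) + n := by
    rw [hα, hn]; noncomm_ring
  have hu : IsUnit (1 - n) :=
    ⟨⟨1 - n, 1 + n, by
      rw [mul_add, sub_mul, sub_mul, hnn]; simp, by rw [mul_sub, add_mul, add_mul, hnn]; simp⟩, rfl⟩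
  obtain ⟨k, hk⟩ : IsUnit (α + (1 - r)) := by
    have : α + (1 - r) = (g : A) * (1 - n) := by
      
      rw [hg, hw, mul_sub, add_mul _ n n, add_mul _ _ n, hαn, hnn, sub_mul 1 r n, hrn]; simp
    rw [this]
    exact g.isUnit.mul hu
  have hkr : (k : A) * r = α := by rw [hk, add_mul, hαr, sub_mul, hr]; simp
  have hrk : r * (k : A) = α := by rw [hk, mul_add, hrα, mul_sub, hr]; simp
  have hcomm : r * (↑k⁻¹ : A) = ↑k⁻¹ * r := by
    rw [Units.eq_inv_mul_iff_mul_eq, ← mul_assoc, hkr, ← hrk, mul_assoc, Units.mul_inv, mul_one]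
  refine ⟨r * c, r * ↑k⁻¹, ?_, ?_, ?_, ?_⟩
  · change r * ↑k⁻¹ * α = r
    rw [← hkr, mul_assoc, ← mul_assoc _ (k : A), Units.inv_mul, one_mul, hr]
  · change α * (r * ↑k⁻¹) = r
    rw [← mul_assoc, hαr, ← hrk, mul_assoc, Units.mul_inv, mul_one]
  · rw [← mul_assoc, hr]
  · rw [← mul_assoc, hr]

variable {A : Type*}

lemma FamEquiv.of_schur [Ring A] {ι κ ν : Type*} [Fintype ι] [Fintype κ] [Fintype ν]
    [DecidableEq ι] [DecidableEq κ] {p : ι → A} {q : κ → A}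
    {R a a' : Matrix ν ν A} {b : Matrix ν ι A} {c : Matrix κ ν A} {d : Matrix κ ι A}
    {b₂ : Matrix ν κ A} {c₂ : Matrix ι ν A} {d₂ : Matrix ι κ A}
    (h₁ : c₂ * a + d₂ * c = 0) (h₂ : c₂ * b + d₂ * d = diagonal p)
    (h₃ : a * b₂ + b * d₂ = 0) (h₄ : c * b₂ + d * d₂ = diagonal q)
    (ha : a' * a = R) (ha' : a * a' = R) (hb : R * b = b) (hb₂ : R * b₂ = b₂)
    (hbp : b * diagonal p = b) (hdp : d * diagonal p = d) (hdq : d₂ * diagonal q = d₂) :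
    FamEquiv p q := by
  refine ⟨d - c * a' * b, d₂, ?_, ?_, ?_, hdq⟩
  · rw [Matrix.mul_sub, ← h₂, ← Matrix.mul_assoc, ← Matrix.mul_assoc,
      eq_neg_of_add_eq_zero_right h₁, Matrix.neg_mul, Matrix.neg_mul, Matrix.mul_assoc c₂, ha', Matrix.mul_assoc c₂, hb,
      sub_neg_eq_add, add_comm]
  · rw [Matrix.sub_mul, ← h₄, Matrix.mul_assoc, eq_neg_of_add_eq_zero_right h₃,
      Matrix.mul_neg, Matrix.mul_assoc c, ← Matrix.mul_assoc a', ha, hb₂, sub_neg_eq_add, add_comm]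
  · rw [Matrix.sub_mul, hdp, Matrix.mul_assoc _ b, hbp]

lemma FamEquiv.cancel_left [NormedRing A] [CompleteSpace A]
    (hsr1 : Dense {a : A | IsUnit a}) {ι κ : Type*} [Fintype ι] [Fintype κ] [DecidableEq ι]
    [DecidableEq κ] {p : ι → A} {q : κ → A} {r : A} (hr : r * r = r)
    (h : FamEquiv (Sum.elim (fun _ : Unit => r) p) (Sum.elim (fun _ : Unit => r) q)) :
    FamEquiv p q := by
  obtain ⟨v, w, h₁, h₂, h₃, h₄⟩ := h
  have h₅ : diagonal (Sum.elim (fun _ : Unit => r) q) * v = v := by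
    rw [← h₂, Matrix.mul_assoc, h₁, h₃]
  have h₆ : diagonal (Sum.elim (fun _ : Unit => r) p) * w = w := by
    rw [← h₁, Matrix.mul_assoc, h₂, h₄]
  obtain ⟨a, b, c, d, rfl⟩ : ∃ a b c d, v = fromBlocks a b c d :=
    ⟨_, _, _, _, (fromBlocks_toBlocks v).symm⟩
  obtain ⟨a', b', c', d', rfl⟩ : ∃ a b c d, w = fromBlocks a b c d :=
    ⟨_, _, _, _, (fromBlocks_toBlocks w).symm⟩
  simp only [← fromBlocks_diagonal, fromBlocks_multiply, fromBlocks_inj, Matrix.mul_zero,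
    Matrix.zero_mul, add_zero, zero_add] at h₁ h₂ h₃ h₄ h₅ h₆
  set R : Matrix Unit Unit A := diagonal fun _ => r with hR
  obtain ⟨p₁, p₂, p₃, p₄⟩ := h₁
  obtain ⟨q₁, q₂, q₃, q₄⟩ := h₂
  obtain ⟨v₁, v₂, v₃, v₄⟩ := h₃
  obtain ⟨w₁, w₂, w₃, w₄⟩ := h₄
  obtain ⟨v₁', v₂', v₃', v₄'⟩ := h₅
  obtain ⟨w₁', w₂', w₃', w₄'⟩ := h₆
  have entry : ∀ {m n : Matrix Unit Unit A}, m () () = n () () → m = n := by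
    intro m n h; ext i j; exact h
  have mulE : ∀ m n : Matrix Unit Unit A, (m * n) () () = m () () * n () () := by
    intro m n; simp [Matrix.mul_apply]
  have RE : R () () = r := by simp [hR]
  have ext' : ∀ {m n : Matrix Unit Unit A}, m = n → m () () = n () () := fun h => by rw [h]
  obtain ⟨y, α, hy₁, hy₂, hy₃, hy₄⟩ := exists_corner_inverse hsr1 (r := r) (x := a' () ())
    (a := a () ()) (b := (b' * c) () ()) hr
    (by rw [← RE, ← mulE, w₁]) (by rw [← RE, ← mulE, v₁'])
    (by rw [← RE, ← mulE, v₁])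
    (by rw [← RE, ← mulE, Matrix.mul_assoc, v₃])
    (by have := ext' p₁
        rwa [Matrix.add_apply, mulE, RE] at this)
  set Y : Matrix Unit Unit A := diagonal fun _ => y
  set α' : Matrix Unit Unit A := diagonal fun _ => α
  have hY : Y () () = y := by simp [Y]
  have hα' : α' () () = α := by simp [α']
  have k₁ : α' * (a + Y * (b' * c)) = R := entry (by
    rw [mulE, Matrix.add_apply, mulE, hα', hY, hy₁, RE])
  have k₂ : (a + Y * (b' * c)) * α' = R := entry (by
    rw [mulE, Matrix.add_apply, mulE, hα', hY, hy₂, RE])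
  have k₄ : R * Y = Y := entry (by rw [mulE, RE, hY, hy₄])
  refine FamEquiv.of_schur (R := R) (a := a + Y * (b' * c)) (a' := α') (b := b + Y * (b' * d))
    (c := c) (d := d) (b₂ := b' - a' * (Y * b')) (c₂ := c') (d₂ := d' - c' * (Y * b'))
    ?_ ?_ ?_ ?_ k₁ k₂ ?_ ?_ ?_ v₄ ?_
  · rw [Matrix.mul_add, Matrix.sub_mul, ← p₃]; simp only [Matrix.mul_assoc]; abel
  · rw [Matrix.mul_add, Matrix.sub_mul, ← p₄]; simp only [Matrix.mul_assoc]; abel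
  · have expand : (a + Y * (b' * c)) * (b' - a' * (Y * b')) + (b + Y * (b' * d)) *
        (d' - c' * (Y * b')) = a * b' + b * d' - (a * a' + b * c') * (Y * b')
          + Y * b' * (c * b' + d * d') - Y * b' * (c * a' + d * c') * (Y * b') := by
      simp only [Matrix.mul_add, Matrix.add_mul, Matrix.mul_sub, Matrix.mul_assoc]
      abel
    rw [expand, q₁, q₂, q₃, q₄, ← Matrix.mul_assoc R, k₄, Matrix.mul_assoc Y, w₂]
    simp
  · have expand : c * (b' - a' * (Y * b')) + d * (d' - c' * (Y * b'))
        = c * b' + d * d' - (c * a' + d * c') * (Y * b') := by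
      simp only [Matrix.add_mul, Matrix.mul_sub, Matrix.mul_assoc]
      abel
    rw [expand, q₃, q₄]; simp
  · rw [Matrix.mul_add, v₂', ← Matrix.mul_assoc, k₄]
  · rw [Matrix.mul_sub, w₂', ← Matrix.mul_assoc, w₁']
  · rw [Matrix.add_mul, v₂, Matrix.mul_assoc, Matrix.mul_assoc, v₄]
  · rw [Matrix.sub_mul, w₄, Matrix.mul_assoc, Matrix.mul_assoc, w₂]

end Cancellation

section ProjMonoid

open Matrix

variable (A : Type*) [Ring A] [StarRing A]

/-- A finite family of projections of `A`. -/
structure ProjFamily where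
  /-- the index type -/
  ι : Type
  [fintype : Fintype ι]
  [decEq : DecidableEq ι]
  /-- the projections -/
  p : ι → A
  isStarProjection : ∀ i, IsStarProjection (p i)

attribute [instance] ProjFamily.fintype ProjFamily.decEq

instance ProjFamily.instSetoid : Setoid (ProjFamily A) where
  r P Q := FamEquiv P.p Q.p
  iseqv :=
    ⟨fun P => FamEquiv.refl fun i => (P.isStarProjection i).isIdempotentElem, FamEquiv.symm,
      FamEquiv.trans⟩

/-- The dimension monoid generated by the projections of `A`. -/
def ProjMonoid := Quotient (ProjFamily.instSetoid A)

variable {A}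

/-- The class of a family of projections. -/
def ProjMonoid.mk (P : ProjFamily A) : ProjMonoid A := Quotient.mk _ P

lemma ProjMonoid.mk_eq_mk {P Q : ProjFamily A} :
    ProjMonoid.mk P = ProjMonoid.mk Q ↔ FamEquiv P.p Q.p := Quotient.eq

/-- The concatenation of two families. -/
def ProjFamily.sum (P Q : ProjFamily A) : ProjFamily A where
  ι := P.ι ⊕ Q.ι
  p := Sum.elim P.p Q.p
  isStarProjection := by
    rintro (i | i)
    · exact P.isStarProjection i
    · exact Q.isStarProjection i

/-- The empty family. -/
def ProjFamily.nil : ProjFamily A where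
  ι := Empty
  p := Empty.elim
  isStarProjection i := i.elim

lemma ProjMonoid.mk_eq_mk_of_equiv {P Q : ProjFamily A} (e : P.ι ≃ Q.ι)
    (h : ∀ i, Q.p (e i) = P.p i) : ProjMonoid.mk P = ProjMonoid.mk Q :=
  ProjMonoid.mk_eq_mk.2
    (FamEquiv.reindex e (fun i => (P.isStarProjection i).isIdempotentElem) h)

instance : Add (ProjMonoid A) :=
  ⟨Quotient.map₂ ProjFamily.sum fun _ _ h _ _ h' => FamEquiv.sum h h'⟩

instance : Zero (ProjMonoid A) := ⟨ProjMonoid.mk ProjFamily.nil⟩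

instance : AddCommMonoid (ProjMonoid A) where
  nsmul := nsmulRec
  add_assoc := by
    rintro ⟨P⟩ ⟨Q⟩ ⟨R⟩
    refine ProjMonoid.mk_eq_mk_of_equiv (P := (P.sum Q).sum R) (Q := P.sum (Q.sum R))
      (Equiv.sumAssoc _ _ _) ?_
    rintro ((i | i) | i) <;> rfl
  zero_add := by
    rintro ⟨P⟩
    refine ProjMonoid.mk_eq_mk_of_equiv (P := ProjFamily.nil.sum P) (Q := P)
      (Equiv.emptySum Empty _) ?_
    rintro (i | i)
    · exact i.elim
    · rfl
  add_zero := by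
    rintro ⟨P⟩
    refine ProjMonoid.mk_eq_mk_of_equiv (P := P.sum ProjFamily.nil) (Q := P)
      (Equiv.sumEmpty _ Empty) ?_
    rintro (i | i)
    · rfl
    · exact i.elim
  add_comm := by
    rintro ⟨P⟩ ⟨Q⟩
    refine ProjMonoid.mk_eq_mk_of_equiv (P := P.sum Q) (Q := Q.sum P)
      (Equiv.sumComm _ _) ?_
    rintro (i | i) <;> rfl

namespace ProjMonoid

lemma mk_sum (P Q : ProjFamily A) : mk (P.sum Q) = mk P + mk Q := rfl

lemma mk_nil : mk (ProjFamily.nil : ProjFamily A) = 0 := rfl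

open Classical in
/-- The class of a projection (with value `0` at elements which are not projections). -/
noncomputable def cls (p : A) : ProjMonoid A :=
  if h : IsStarProjection p then mk ⟨Unit, fun _ => p, fun _ => h⟩ else 0

lemma cls_eq_mk {p : A} (h : IsStarProjection p) :
    cls p = mk ⟨Unit, fun _ => p, fun _ => h⟩ := dif_pos h

lemma cls_eq_cls_iff {p q : A} (hp : IsStarProjection p) (hq : IsStarProjection q) :
    cls p = cls q ↔ ∃ x y, y * x = p ∧ x * y = q ∧ x * p = x ∧ y * q = y := by
  rw [cls_eq_mk hp, cls_eq_mk hq, mk_eq_mk]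
  constructor
  · rintro ⟨v, w, h₁, h₂, h₃, h₄⟩
    refine ⟨v () (), w () (), ?_, ?_, ?_, ?_⟩
    · simpa [Matrix.mul_apply] using congrFun (congrFun h₁ ()) ()
    · simpa [Matrix.mul_apply] using congrFun (congrFun h₂ ()) ()
    · simpa [Matrix.mul_apply] using congrFun (congrFun h₃ ()) ()
    · simpa [Matrix.mul_apply] using congrFun (congrFun h₄ ()) ()
  · rintro ⟨x, y, h₁, h₂, h₃, h₄⟩
    refine ⟨diagonal fun _ => x, diagonal fun _ => y, ?_, ?_, ?_, ?_⟩ <;>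
    simp [diagonal_mul_diagonal, *]

lemma cls_add {p q : A} (hp : IsStarProjection p) (hq : IsStarProjection q) (hpq : p * q = 0) :
    cls (p + q) = cls p + cls q := by
  have hqp : q * p = 0 := by
    have := congrArg star hpq
    rwa [star_mul, hp.isSelfAdjoint.star_eq, hq.isSelfAdjoint.star_eq, star_zero] at this
  rw [cls_eq_mk hp, cls_eq_mk hq, cls_eq_mk (hp.add hq hpq), ← mk_sum, mk_eq_mk]
  have hp' : p * p = p := hp.isIdempotentElem
  have hq' : q * q = q := hq.isIdempotentElem
  suffices h : FamEquiv (fun _ : Unit => p + q)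
      (Sum.elim (fun _ : Unit => p) fun _ : Unit => q) by exact h
  refine ⟨of (Sum.elim (fun _ _ => p) fun _ _ => q), of fun _ => Sum.elim (fun _ => p) fun _ => q,
    ?_, ?_, ?_, ?_⟩
  · ext i j
    simp [Matrix.mul_apply, hp', hq']
  · ext (i | i) (j | j) <;> simp [Matrix.mul_apply, hp', hq', hpq, hqp]
  · ext (i | i) j <;> simp [hp', hq', hpq, hqp, mul_add]
  · ext i (j | j) <;> simp [hp', hq']

lemma mk_eq_zero_iff {P : ProjFamily A} : mk P = 0 ↔ ∀ i, P.p i = 0 := by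
  rw [← mk_nil, mk_eq_mk]
  constructor
  · rintro ⟨v, w, h₁, -⟩ i
    have := congrFun (congrFun h₁ i) i
    rw [Matrix.mul_apply, diagonal_apply_eq] at this
    rw [← this]
    exact Finset.sum_eq_zero fun j _ => j.elim
  · intro h
    refine ⟨0, 0, ?_, ?_, ?_, ?_⟩
    · ext i j
      simp [diagonal, h]
    · ext i
      exact i.elim
    · simp
    · simp

lemma cls_eq_zero_iff {p : A} (hp : IsStarProjection p) : cls p = 0 ↔ p = 0 := by
  rw [cls_eq_mk hp, mk_eq_zero_iff]
  exact ⟨fun h => h (), fun h _ => h⟩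

@[simp] lemma cls_zero : cls (0 : A) = 0 := (cls_eq_zero_iff (.zero A)).2 rfl

lemma eq_zero_of_add_eq_zero {m n : ProjMonoid A} (h : m + n = 0) : m = 0 := by
  obtain ⟨P, rfl⟩ : ∃ P, mk P = m := Quotient.exists_rep m
  obtain ⟨Q, rfl⟩ : ∃ P, mk P = n := Quotient.exists_rep n
  rw [← mk_sum, mk_eq_zero_iff] at h
  exact mk_eq_zero_iff.2 fun i => h (Sum.inl i)

lemma mk_eq_sum (P : ProjFamily A) : mk P = ∑ i, cls (P.p i) := by
  obtain ⟨ι, p, hp⟩ := P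
  rename_i hι hd
  have key : ∀ (κ : Type) [Fintype κ], ∀ [DecidableEq κ] (q : κ → A)
      (hq : ∀ i, IsStarProjection (q i)), mk ⟨κ, q, hq⟩ = ∑ i, cls (q i) := by
    intro κ _
    refine Fintype.induction_empty_option (P := fun κ _ => ∀ [DecidableEq κ] (q : κ → A)
      (hq : ∀ i, IsStarProjection (q i)), mk ⟨κ, q, hq⟩ = ∑ i, cls (q i)) ?_ ?_ ?_ κ
    · intro α β _ e ih _ q hq
      let := Fintype.ofEquiv β e.symm
      classical
      rw [← Equiv.sum_comp e, ← ih (fun i => q (e i)) fun i => hq _]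
      exact (mk_eq_mk_of_equiv (P := ⟨α, fun i => q (e i), fun i => hq _⟩) (Q := ⟨β, q, hq⟩)
        e fun i => rfl).symm
    · intro _ q hq
      rw [Finset.univ_eq_empty, Finset.sum_empty]
      exact mk_eq_zero_iff.2 fun i => i.elim
    · intro α _ ih _ q hq
      classical
      rw [Fintype.sum_option, ← ih (fun i => q (some i)) fun i => hq _, cls_eq_mk (hq none),
        add_comm, ← mk_sum]
      refine mk_eq_mk_of_equiv (P := ⟨Option α, q, hq⟩) (Q := ProjFamily.sum ⟨_, _, _⟩ ⟨_, _, _⟩)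
        (Equiv.optionEquivSumPUnit α) ?_
      rintro (_ | i) <;> rfl
  exact key ι p hp

lemma induction_on {motive : ProjMonoid A → Prop} (m : ProjMonoid A) (zero : motive 0)
    (cls_add : ∀ p m, IsStarProjection p → motive m → motive (cls p + m)) : motive m := by
  obtain ⟨P, rfl⟩ : ∃ P, mk P = m := Quotient.exists_rep m
  rw [mk_eq_sum]
  induction (Finset.univ : Finset P.ι) using Finset.induction_on with
  | empty => simpa using zero
  | insert i s hi ih =>
    rw [Finset.sum_insert hi]
    exact cls_add _ _ (P.isStarProjection i) ih

lemma exists_of_cls_add_eq_sum {p : A} (hp : IsStarProjection p) {m : ProjMonoid A} {J : Type}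
    [Fintype J] {q : J → A} (hq : ∀ j, IsStarProjection (q j)) (h : cls p + m = ∑ j, cls (q j)) :
    ∃ v w : J → A, ∑ j, w j * v j = p ∧ (∀ j, q j * v j = v j) ∧ ∀ j, v j * p = v j := by
  classical
  obtain ⟨Q, rfl⟩ : ∃ P, mk P = m := Quotient.exists_rep m
  rw [← mk_eq_sum ⟨J, q, hq⟩, cls_eq_mk hp, ← mk_sum, mk_eq_mk] at h
  have h' : FamEquiv (Sum.elim (fun _ : Unit => p) Q.p) q := h
  obtain ⟨v, w, h₁, h₂, h₃, h₄⟩ := h'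
  have h₅ : diagonal q * v = v := by rw [← h₂, Matrix.mul_assoc, h₁, h₃]
  refine ⟨fun j => v j (Sum.inl ()), fun j => w (Sum.inl ()) j, ?_, fun j => ?_, fun j => ?_⟩
  · simpa [Matrix.mul_apply] using
      congrFun (congrFun h₁ (Sum.inl ())) (Sum.inl ())
  · simpa using congrFun (congrFun h₅ j) (Sum.inl ())
  · simpa using congrFun (congrFun h₃ j) (Sum.inl ())

lemma cls_sum {ι : Type*} {p : ι → A} {s : Finset ι} (hp : ∀ i ∈ s, IsStarProjection (p i))
    (h : ∀ i ∈ s, ∀ j ∈ s, i ≠ j → p i * p j = 0) :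
    IsStarProjection (∑ i ∈ s, p i) ∧ cls (∑ i ∈ s, p i) = ∑ i ∈ s, cls (p i) := by
  induction s using Finset.cons_induction with
  | empty => simp [IsStarProjection.zero]
  | cons i s hi ih =>
    obtain ⟨h₁, h₂⟩ := ih (fun j hj => hp j (by simp [hj]))
      (fun j hj k hk => h j (by simp [hj]) k (by simp [hk]))
    have h₃ : p i * ∑ j ∈ s, p j = 0 := by
      rw [Finset.mul_sum]
      exact Finset.sum_eq_zero fun j hj =>
        h i (by simp) j (by simp [hj]) (by rintro rfl; exact hi hj)
    rw [Finset.sum_cons, Finset.sum_cons, ← h₂]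
    exact ⟨(hp i (by simp)).add h₁ h₃, cls_add (hp i (by simp)) h₁ h₃⟩

end ProjMonoid

lemma ProjMonoid.add_left_cancel_of_dense {A : Type*} [NormedRing A] [StarRing A] [CompleteSpace A]
    (hsr1 : Dense {a : A | IsUnit a}) {l m n : ProjMonoid A} (h : l + m = l + n) : m = n := by
  induction l using ProjMonoid.induction_on with
  | zero => simpa using h
  | cls_add p l hp ih =>
    apply ih
    rw [add_assoc, add_assoc] at h
    generalize l + m = m' at h
    generalize l + n = n' at h
    obtain ⟨P, rfl⟩ : ∃ P, mk P = m' := Quotient.exists_rep m'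
    obtain ⟨Q, rfl⟩ : ∃ P, mk P = n' := Quotient.exists_rep n'
    rw [cls_eq_mk hp, ← mk_sum, ← mk_sum, mk_eq_mk] at h
    exact mk_eq_mk.2 (FamEquiv.cancel_left hsr1 hp.isIdempotentElem h)

end ProjMonoid

section Projections

variable {A : Type*} [CStarAlgebra A] [PartialOrder A] [StarOrderedRing A]

lemma isUnit_of_one_le_smul {h : A} {c : ℝ} (hc : 0 < c) (h1 : 1 ≤ c • h) : IsUnit h := by
  have h2 : IsUnit (c • h) := CStarAlgebra.isUnit_of_le 1 h1
  have h3 : h = (Units.mk0 c hc.ne')⁻¹ • (c • h) := by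
    rw [Units.smul_def, smul_smul]
    simp [hc.ne']
  rw [h3]
  exact h2.smul _

/-- An element which is bounded below on the range of `p` has an inverse square modulus there. -/
lemma IsStarProjection.exists_corner_inv {p x : A} (hp : IsStarProjection p) (hxp : x * p = x)
    {c : ℝ} (h : p ≤ c • (star x * x)) :
    ∃ k, IsSelfAdjoint k ∧ k * (star x * x) = p ∧ p * k = k ∧ k * p = k := by
  have hpx : p * star x = star x := by
    simpa [hp.isSelfAdjoint.star_eq] using congrArg star hxp
  have hpp : p * p = p := hp.isIdempotentElem
  have hc : p ≤ max 1 c • (star x * x) :=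
    h.trans (smul_le_smul_of_nonneg_right (le_max_right _ _) (star_mul_self_nonneg x))
  have hu : IsUnit (star x * x + (1 - p)) := by
    refine isUnit_of_one_le_smul (c := max 1 c) (by positivity) ?_
    have h1 : (0 : A) ≤ 1 - p := hp.one_sub.nonneg
    have h2 : (1 : ℝ) • (1 - p) ≤ max 1 c • (1 - p) :=
      smul_le_smul_of_nonneg_right (le_max_left _ _) h1
    calc (1 : A) = p + (1 : ℝ) • (1 - p) := by rw [one_smul]; abel
      _ ≤ _ := by rw [smul_add]; exact add_le_add hc h2
  obtain ⟨u, hu⟩ := hu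
  have e1 : (u : A) * p = star x * x := by
    rw [hu, add_mul, mul_assoc, hxp, sub_mul, hpp, one_mul, sub_self, add_zero]
  have e2 : p * (u : A) = star x * x := by
    rw [hu, mul_add, ← mul_assoc, hpx, mul_sub, hpp, mul_one, sub_self, add_zero]
  have hsu : IsSelfAdjoint (u : A) := by
    rw [hu]
    exact (IsSelfAdjoint.star_mul_self x).add (hp.one_sub.isSelfAdjoint)
  have hsi : IsSelfAdjoint ((u⁻¹ : Aˣ) : A) := by
    have : star u = u := Units.ext (by simpa using hsu.star_eq)
    rw [IsSelfAdjoint, ← Units.coe_star, star_inv, this]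
  have hcomm : Commute p (u : A) := e2.trans e1.symm
  have hcomm' : Commute p ((u⁻¹ : Aˣ) : A) := hcomm.units_inv_right
  have e3 : p * ((u⁻¹ : Aˣ) : A) = ((u⁻¹ : Aˣ) : A) * p := hcomm'
  refine ⟨p * ((u⁻¹ : Aˣ) : A), ?_, ?_, ?_, ?_⟩
  · exact (hp.isSelfAdjoint.commute_iff hsi).1 hcomm'
  · rw [← e1, mul_assoc, ← mul_assoc _ (u : A), Units.inv_mul, one_mul, hpp]
  · rw [← mul_assoc, hpp]
  · rw [e3, mul_assoc, hpp]

lemma IsStarProjection.exists_subprojection {p q x : A} (hp : IsStarProjection p)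
    (hqx : q * x = x) (hxp : x * p = x) {c : ℝ} (h : p ≤ c • (star x * x)) :
    ∃ e, IsStarProjection e ∧ q * e = e ∧ ProjMonoid.cls p = ProjMonoid.cls e := by
  obtain ⟨k, hk, h1, h2, h3⟩ := hp.exists_corner_inv hxp h
  have he : IsStarProjection (x * k * star x) := by
    refine ⟨?_, ?_⟩
    · rw [IsIdempotentElem]
      calc x * k * star x * (x * k * star x) = x * (k * (star x * x)) * k * star x := by
            simp only [mul_assoc]
        _ = _ := by rw [h1, hxp]
    · rw [IsSelfAdjoint, star_mul, star_mul, star_star, hk.star_eq, mul_assoc]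
  refine ⟨x * k * star x, he, ?_, ?_⟩
  · rw [← mul_assoc, ← mul_assoc, hqx]
  · refine (ProjMonoid.cls_eq_cls_iff hp he).2 ⟨x, k * star x, ?_, ?_, hxp, ?_⟩
    · rw [mul_assoc, h1]
    · rw [mul_assoc]
    · calc k * star x * (x * k * star x) = (k * (star x * x)) * k * star x := by
            simp only [mul_assoc]
        _ = _ := by rw [h1, h2]

lemma le_norm_smul_star_mul_self (y x : A) :
    star (y * x) * (y * x) ≤ ‖star y * y‖ • (star x * x) := by
  have := CStarAlgebra.star_left_conjugate_le_norm_smul (a := x) (IsSelfAdjoint.star_mul_self y)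
  simpa only [star_mul, mul_assoc] using this

/-- If `‖p - p b q c p‖ < 1` then `p` is equivalent to a subprojection of `q`. -/
lemma IsStarProjection.exists_subprojection_of_norm_lt {p q b c : A} (hp : IsStarProjection p)
    (hq : IsStarProjection q) (h : ‖p - p * b * q * c * p‖ < 1) :
    ∃ e, IsStarProjection e ∧ q * e = e ∧ ProjMonoid.cls p = ProjMonoid.cls e := by
  have hpp : p * p = p := hp.isIdempotentElem
  have hqq : q * q = q := hq.isIdempotentElem
  set u := Units.oneSub (p - p * b * q * c * p) h with hu
  have e1 : (u : A) * p = p * b * q * c * p := by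
    simp only [hu, Units.val_oneSub, sub_mul, one_mul, hpp, mul_assoc]
    abel
  have e2 : ((u⁻¹ : Aˣ) : A) * p * b * q * (q * c * p) = p := by
    have : ((u⁻¹ : Aˣ) : A) * p * b * q * (q * c * p) = ((u⁻¹ : Aˣ) : A) *
        (p * b * (q * q) * c * p) := by simp only [mul_assoc]
    rw [this, hqq, ← e1, Units.inv_mul_cancel_left]
  refine hp.exists_subprojection (x := q * c * p)
    (c := ‖star (((u⁻¹ : Aˣ) : A) * p * b * q) * (((u⁻¹ : Aˣ) : A) * p * b * q)‖) ?_ ?_ ?_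
  · rw [← mul_assoc, ← mul_assoc, hqq]
  · rw [mul_assoc, hpp]
  · have := le_norm_smul_star_mul_self (((u⁻¹ : Aˣ) : A) * p * b * q) (q * c * p)
    rwa [e2, hp.isSelfAdjoint.star_eq, hpp] at this

end Projections

section CornerInvertibles

variable {A : Type*} [CStarAlgebra A]

/-- Selfadjoint elements of the corner `pAp` are approximated by selfadjoint elements of the
corner which are invertible there. -/
lemma IsStarProjection.exists_corner_isUnit
    (hrr0 : ∀ a : A, IsSelfAdjoint a → a ∈ closure {b : A | IsSelfAdjoint b ∧ IsUnit b})
    {p a : A} (hp : IsStarProjection p) (ha : IsSelfAdjoint a) (hpa : p * a = a) {δ : ℝ}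
    (hδ : 0 < δ) :
    ∃ s, IsSelfAdjoint s ∧ p * s = s ∧ s * p = s ∧ ‖s - a‖ < δ ∧ IsUnit (s - (1 - p)) := by
  obtain ⟨q, hq⟩ : ∃ q, q = 1 - p := ⟨_, rfl⟩
  have hpp : p * p = p := hp.isIdempotentElem
  have hap : a * p = a := by
    simpa [hp.isSelfAdjoint.star_eq, ha.star_eq] using congrArg star hpa
  have hqq : q * q = q := by rw [hq]; exact hp.one_sub.isIdempotentElem
  have hpq : p * q = 0 := by rw [hq, mul_sub, hpp, mul_one, sub_self]
  have hqp : q * p = 0 := by rw [hq, sub_mul, hpp, one_mul, sub_self]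
  have h1 : p + q = 1 := by rw [hq]; abel
  have sp : star p = p := hp.isSelfAdjoint
  have sq : star q = q := by rw [hq]; exact hp.one_sub.isSelfAdjoint
  have hpp' (x : A) : p * (p * x) = p * x := by rw [← mul_assoc, hpp]
  have hqq' (x : A) : q * (q * x) = q * x := by rw [← mul_assoc, hqq]
  have hpq' (x : A) : p * (q * x) = 0 := by rw [← mul_assoc, hpq, zero_mul]
  have hqp' (x : A) : q * (p * x) = 0 := by rw [← mul_assoc, hqp, zero_mul]
  let F : A → A := fun c => p * c * p - p * c * q * Ring.inverse (p + q * c * q) * (q * c * p)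
  have hF : ContinuousAt F (a + q) := by
    have : p + q * (a + q) * q = ((1 : Aˣ) : A) := by
      rw [mul_add, ← hpa, hqp', zero_add, hqq, hqq, h1, Units.val_one]
    have h2 : ContinuousAt Ring.inverse (p + q * (a + q) * q) := by
      rw [this]; exact NormedRing.inverse_continuousAt 1
    have h3 : ContinuousAt (fun c => Ring.inverse (p + q * c * q)) (a + q) :=
      ContinuousAt.comp (f := fun c => p + q * c * q) h2 (by fun_prop)
    fun_prop
  have hFa : F (a + q) = a := by
    simp only [F]
    rw [mul_add, hpa, hpq, add_zero, hap, ← hap, mul_assoc a p q, hpq]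
    simp [hap]
  have h2 : ∀ᶠ c in 𝓝 (a + q), ‖F c - a‖ < δ := by
    have := hF.eventually (Metric.ball_mem_nhds _ hδ)
    rw [hFa] at this
    filter_upwards [this] with c hc
    rwa [← dist_eq_norm]
  have h3 : ∀ᶠ c in 𝓝 (a + q), IsUnit (p + q * c * q) := by
    have h4 : ContinuousAt (fun c => p + q * c * q) (a + q) := by fun_prop
    refine h4.eventually (Units.isOpen.mem_nhds ?_)
    have : p + q * (a + q) * q = 1 := by
      rw [mul_add, ← hpa, hqp', zero_add, hqq, hqq, h1]
    simp [this]
  have hsa : IsSelfAdjoint (a + q) := ha.add sq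
  obtain ⟨c, ⟨hc, hcu⟩, hcδ, u, hu⟩ :=
    ((mem_closure_iff_frequently.1 (hrr0 _ hsa)).and_eventually (h2.and h3)).exists
  obtain ⟨d, hd⟩ : ∃ d : A, d = ((u⁻¹ : Aˣ) : A) := ⟨_, rfl⟩
  have hFc : F c = p * c * p - p * c * q * d * (q * c * p) := by
    simp only [F]
    rw [← hu, Ring.inverse_unit, hd]
  have hud : (p + q * c * q) * d = 1 := by rw [← hu, hd, Units.mul_inv]
  have hdu : d * (p + q * c * q) = 1 := by rw [← hu, hd, Units.inv_mul]
  have hsd : star d = d := by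
    have h4 : star d * (p + q * c * q) = 1 := by
      have := congrArg star hud
      simpa [sp, sq, hc.star_eq, mul_assoc] using this
    calc star d = star d * ((p + q * c * q) * d) := by rw [hud, mul_one]
      _ = d := by rw [← mul_assoc, h4, one_mul]
  have hpd : p * d = p := by
    have : p * ((p + q * c * q) * d) = p * d := by
      simp only [add_mul, mul_add, mul_assoc, hpp', hpq', add_zero]
    rw [← this, hud, mul_one]
  have hdp : d * p = p := by
    have := congrArg star hpd
    simpa [sp, hsd] using this
  have hpd' (x : A) : p * (d * x) = p * x := by rw [← mul_assoc, hpd]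
  have hdp' (x : A) : d * (p * x) = p * x := by rw [← mul_assoc, hdp]
  have hqd : q * d = d * q := by rw [hq, sub_mul, mul_sub, hpd, hdp, one_mul, mul_one]
  have hqd' (x : A) : q * (d * x) = d * (q * x) := by rw [← mul_assoc, hqd, mul_assoc]
  have hcd : q * (c * (d * q)) = q := by
    have : ((p + q * c * q) * d) * q = q := by rw [hud, one_mul]
    simpa only [add_mul, mul_assoc, hpd', hpq, zero_add, hqd', hqq] using this
  have hdc : d * (q * (c * q)) = q := by
    have := congrArg star hcd
    simpa only [star_mul, sp, sq, hsd, hc.star_eq, mul_assoc, hqd'] using this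
  have hcd' (x : A) : q * (c * (d * (q * x))) = q * x := by
    have := congrArg (· * x) hcd
    simpa only [mul_assoc] using this
  have hdc' (x : A) : d * (q * (c * (q * x))) = q * x := by
    have := congrArg (· * x) hdc
    simpa only [mul_assoc] using this
  have hps : p * F c = F c := by
    rw [hFc]; simp only [mul_sub, mul_assoc, hpp']
  have hsp : F c * p = F c := by
    rw [hFc]; simp only [sub_mul, mul_assoc, hpp]
  have hss : IsSelfAdjoint (F c) := by
    rw [IsSelfAdjoint, hFc]
    simp only [star_sub, star_mul, sp, sq, hsd, hc.star_eq, mul_assoc]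
  refine ⟨F c, hss, hps, hsp, hcδ, ?_⟩
  rw [← hq]
  have hn : IsUnit (1 - p * c * q * d * q) := by
    refine isUnit_iff_exists.2 ⟨1 + p * c * q * d * q, ?_, ?_⟩ <;>
    simp [mul_add, mul_sub, add_mul, sub_mul, mul_assoc, hqp', hqd']
  have hn' : IsUnit (1 - d * (q * c * p)) := by
    have := hn.star
    simpa only [star_sub, star_mul, star_one, sp, sq, hsd, hc.star_eq, mul_assoc, hqd', hqq'] 
      using this
  have hr : IsUnit (p - d * q) := by
    have : IsUnit (p - q) := by
      refine isUnit_iff_exists.2 ⟨p - q, ?_, ?_⟩ <;>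
      simp [mul_sub, sub_mul, hpp, hqq, hpq, hqp, h1]
    have h5 : IsUnit d := by rw [hd]; exact Units.isUnit _
    have h6 := h5.mul this
    rwa [mul_sub, hdp] at h6
  have key : F c - q = (1 - p * c * q * d * q) * c * (1 - d * (q * c * p)) * (p - d * q) := by
    have hcc : c = p * c * p + p * c * q + q * c * p + q * c * q := by
      calc c = (p + q) * c * (p + q) := by rw [h1, one_mul, mul_one]
        _ = _ := by noncomm_ring
    have k1 : (1 - p * c * q * d * q) * c = F c + q * c * p + q * c * q := by
      rw [hFc]
      nth_rewrite 2 [hcc]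
      simp only [sub_mul, mul_add, mul_assoc, one_mul, hqp', hqd', hqq', hdc, mul_zero]
      abel
    have hFd : F c * d = F c := by rw [← hsp, mul_assoc, hpd]
    have hFq : F c * q = 0 := by rw [← hsp, mul_assoc, hpq, mul_zero]
    have hFq' (x : A) : F c * (q * x) = 0 := by rw [← mul_assoc, hFq, zero_mul]
    have hFd' (x : A) : F c * (d * x) = F c * x := by rw [← mul_assoc, hFd]
    rw [k1]
    simp only [sub_mul, mul_sub, add_mul, mul_assoc, mul_one, hpd', hpq', hFd', hFq',
      hcd', hcd, hsp, hFq, hpq, mul_zero, zero_mul, hpp, hqp, hqd', hqq, hqq', add_zero]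
    abel
  rw [key]
  exact ((hn.mul hcu).mul hn').mul hr

end CornerInvertibles

section Riesz

variable {A : Type*} [CStarAlgebra A] [PartialOrder A] [StarOrderedRing A]

/-- Approximate spectral projections in a corner. -/
lemma IsStarProjection.exists_split
    (hrr0 : ∀ a : A, IsSelfAdjoint a → a ∈ closure {b : A | IsSelfAdjoint b ∧ IsUnit b})
    {p b : A} (hp : IsStarProjection p) (hb : IsSelfAdjoint b) (l : ℝ) {δ : ℝ} (hδ : 0 < δ) :
    ∃ f g, IsStarProjection f ∧ IsStarProjection g ∧ f + g = p ∧ f * g = 0 ∧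
      (l - δ) • f ≤ f * b * f ∧ g * b * g ≤ (l + δ) • g := by
  have hpp : p * p = p := hp.isIdempotentElem
  have sp : star p = p := hp.isSelfAdjoint
  have ha : IsSelfAdjoint (p * b * p - l • p) := by
    rw [IsSelfAdjoint]
    simp [sp, hb.star_eq, mul_assoc]
  obtain ⟨s, hs, hps, hsp, hsa, hu⟩ := hp.exists_corner_isUnit hrr0 ha
    (by simp only [mul_sub, mul_assoc, mul_smul_comm, hpp, ← mul_assoc p p]) hδ
  set c := s - (1 - p) with hc
  have hcs : IsSelfAdjoint c := hs.sub hp.one_sub.isSelfAdjoint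
  have h0 : (0 : ℝ) ∉ spectrum ℝ c := spectrum.zero_notMem ℝ hu
  have hχ : ContinuousOn (fun x : ℝ => if 0 < x then (1 : ℝ) else 0) (spectrum ℝ c) := by
    intro x hx
    have hx0 : x ≠ 0 := by rintro rfl; exact h0 hx
    apply ContinuousAt.continuousWithinAt
    rcases lt_or_gt_of_ne hx0 with h | h
    · refine continuousAt_const.congr (f := fun _ => (0 : ℝ)) ?_
      filter_upwards [Iio_mem_nhds h] with y hy
      rw [if_neg (not_lt.2 (le_of_lt hy))]
    · refine continuousAt_const.congr (f := fun _ => (1 : ℝ)) ?_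
      filter_upwards [Ioi_mem_nhds h] with y hy
      rw [if_pos (show 0 < y from hy)]
  set f := cfc (fun x : ℝ => if 0 < x then (1 : ℝ) else 0) c with hf
  have hfs : star f = f := (cfc_predicate _ c : IsSelfAdjoint f)
  have hff : f * f = f := by
    rw [hf, ← cfc_mul _ _ c hχ hχ]
    congr 1
    ext x
    split_ifs <;> simp
  have hfc : f * c = c * f := (Commute.cfc_real (Commute.refl c) _)
  have hfc0 : 0 ≤ f * c := by
    have h1 : f * c = cfc (fun x : ℝ => (if 0 < x then (1 : ℝ) else 0) * x) c := by
      rw [cfc_mul _ _ c hχ, cfc_id' ℝ c]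
    rw [h1]
    refine cfc_nonneg fun x _ => ?_
    split_ifs with h
    · simpa using h.le
    · simp
  have hfc1 : c - f * c ≤ 0 := by
    have h1 : f * c - c = cfc (fun x : ℝ => (if 0 < x then (1 : ℝ) else 0) * x - x) c := by
      rw [cfc_sub (fun x : ℝ => (if 0 < x then (1 : ℝ) else 0) * x) (fun x => x) c
        (hχ.mul continuousOn_id), cfc_mul _ _ c hχ, cfc_id' ℝ c]
    have h2 : 0 ≤ f * c - c := by
      rw [h1]
      refine cfc_nonneg fun x _ => ?_
      split_ifs with h
      · simp
      · simpa using not_lt.1 h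
    rw [← neg_sub]
    exact neg_nonpos.2 h2
  -- `f` lies in the corner
  have hc1 : c * (1 - p) = -(1 - p) := by
    rw [hc, sub_mul, hp.one_sub.isIdempotentElem, mul_sub, hsp, mul_one, sub_self, zero_sub]
  have hf1 : f * (1 - p) = 0 := by
    have h1 : star (f * (1 - p)) * (f * (1 - p)) ≤ 0 := by
      have h2 := star_left_conjugate_nonneg hfc0 (1 - p)
      have h3 : star (1 - p) * (f * c) * (1 - p) = -(star (f * (1 - p)) * (f * (1 - p))) := by
        rw [mul_assoc, mul_assoc, hc1, star_mul, hfs, mul_assoc, ← mul_assoc f f, hff, mul_neg,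
          mul_neg]
      rw [h3] at h2
      exact neg_nonneg.1 h2
    exact CStarRing.star_mul_self_eq_zero_iff _ |>.1 (le_antisymm h1 (star_mul_self_nonneg _))
  have hfp : f * p = f := by
    rw [mul_sub, mul_one, sub_eq_zero] at hf1
    exact hf1.symm
  have hpf : p * f = f := by simpa [hfs, sp] using congrArg star hfp
  have hfP : IsStarProjection f := ⟨hff, hfs⟩
  obtain ⟨g, hgdef⟩ : ∃ g, g = p - f := ⟨_, rfl⟩
  have hg : IsStarProjection g := by rw [hgdef]; exact hfP.sub_of_mul_eq_left hp hfp
  have sg : star g = g := hg.isSelfAdjoint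
  have hfg0 : f * g = 0 := by rw [hgdef, mul_sub, hfp, hff, sub_self]
  have hgf0 : g * f = 0 := by rw [hgdef, sub_mul, hpf, hff, sub_self]
  have hgp : g * p = g := by rw [hgdef, sub_mul, hpp, hfp]
  have hpg : p * g = g := by rw [hgdef, mul_sub, hpp, hpf]
  have e1 : f * c * f = f * s * f := by rw [hc, mul_sub, hf1, sub_zero]
  have e2 : g * c * g = g * s * g := by
    have : g * (1 - p) = 0 := by rw [mul_sub, mul_one, hgp, sub_self]
    rw [hc, mul_sub, this, sub_zero]
  have d1 : p * b * p = s + l • p - (s - (p * b * p - l • p)) := by abel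
  have d2 : IsSelfAdjoint (s - (p * b * p - l • p)) := hs.sub ha
  have d3 : s - (p * b * p - l • p) ≤ algebraMap ℝ A δ :=
    d2.le_algebraMap_norm_self.trans (by
      rw [Algebra.algebraMap_eq_smul_one, Algebra.algebraMap_eq_smul_one]
      exact smul_le_smul_of_nonneg_right hsa.le zero_le_one)
  have d4 : -algebraMap ℝ A δ ≤ s - (p * b * p - l • p) :=
    le_trans (by
      rw [Algebra.algebraMap_eq_smul_one, Algebra.algebraMap_eq_smul_one]
      exact neg_le_neg (smul_le_smul_of_nonneg_right hsa.le zero_le_one))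
      d2.neg_algebraMap_norm_le_self
  refine ⟨f, g, hfP, hg, by rw [hgdef]; abel, hfg0, ?_, ?_⟩
  · have k1 := star_left_conjugate_le_conjugate d3 f
    have k2 : (0 : A) ≤ f * s * f := by
      have := star_left_conjugate_nonneg hfc0 f
      rwa [hfs, ← mul_assoc, hff, e1] at this
    have k3 : f * b * f = f * s * f + l • f - f * (s - (p * b * p - l • p)) * f := by
      have : f * b * f = f * (p * b * p) * f := by
        simp only [mul_assoc, hpf]
        rw [← mul_assoc f p, hfp]
      rw [this]
      nth_rewrite 1 [d1]
      simp only [mul_sub, sub_mul, mul_add, add_mul, mul_smul_comm, smul_mul_assoc, hfp, hff]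
    rw [hfs, Algebra.algebraMap_eq_smul_one, mul_smul_comm, mul_one, smul_mul_assoc, hff] at k1
    rw [k3, sub_smul]
    exact sub_le_sub (le_add_of_nonneg_left k2) k1
  · have k1 := star_left_conjugate_le_conjugate d4 g
    have k2 : g * s * g ≤ 0 := by
      have := star_left_conjugate_le_conjugate hfc1 g
      rwa [sg, mul_sub, ← mul_assoc g f, hgf0, zero_mul, sub_zero, mul_zero, zero_mul, e2] at this
    have k3 : g * b * g = g * s * g + l • g - g * (s - (p * b * p - l • p)) * g := by
      have : g * b * g = g * (p * b * p) * g := by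
        simp only [mul_assoc, hpg]
        rw [← mul_assoc g p, hgp]
      rw [this]
      nth_rewrite 1 [d1]
      simp only [mul_sub, sub_mul, mul_add, add_mul, mul_smul_comm, smul_mul_assoc, hgp,
        hg.isIdempotentElem.eq]
    rw [sg, Algebra.algebraMap_eq_smul_one, mul_neg, neg_mul, mul_smul_comm, mul_one,
      smul_mul_assoc, hg.isIdempotentElem] at k1
    rw [k3, add_smul, sub_eq_add_neg]
    exact add_le_add (add_le_of_nonpos_left k2) (neg_le.1 k1)

/-- If a sum of selfadjoint elements is bounded below on a projection, the projection decomposes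
into pieces on which the summands are bounded below. -/
lemma IsStarProjection.exists_riesz
    (hrr0 : ∀ a : A, IsSelfAdjoint a → a ∈ closure {b : A | IsSelfAdjoint b ∧ IsUnit b})
    {ι : Type*} (s : Finset ι) (b : ι → A) (hb : ∀ j ∈ s, IsSelfAdjoint (b j)) {p : A}
    (hp : IsStarProjection p) {ε : ℝ} (hε : 0 < ε) (h : ε • p ≤ ∑ j ∈ s, p * b j * p) :
    ∃ f : ι → A, (∀ j ∈ s, IsStarProjection (f j)) ∧
      (∀ i ∈ s, ∀ j ∈ s, i ≠ j → f i * f j = 0) ∧ ∑ j ∈ s, f j = p ∧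
      ∃ ε' : ℝ, 0 < ε' ∧ ∀ j ∈ s, ε' • f j ≤ f j * b j * f j := by
  classical
  induction s using Finset.cons_induction generalizing p ε with
  | empty =>
    refine ⟨0, by simp, by simp, ?_, 1, one_pos, by simp⟩
    have h1 : ε • p = 0 := le_antisymm (by simpa using h) (smul_nonneg hε.le hp.nonneg)
    simpa using ((smul_eq_zero.1 h1).resolve_left hε.ne').symm
  | cons j s hj ih =>
    obtain ⟨f, g, hf, hg, hfg, hfg0, h1, h2⟩ :=
      hp.exists_split hrr0 (hb j (by simp)) (ε / 2) (δ := ε / 4) (by positivity)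
    have hff : f * f = f := hf.isIdempotentElem
    have hgg : g * g = g := hg.isIdempotentElem
    have sg : star g = g := hg.isSelfAdjoint
    have hgf0 : g * f = 0 := by
      simpa [hf.isSelfAdjoint.star_eq, sg] using congrArg star hfg0
    have hgp : g * p = g := by rw [← hfg, mul_add, hgf0, hgg, zero_add]
    have hpg : p * g = g := by rw [← hfg, add_mul, hfg0, hgg, zero_add]
    have h3 : (ε / 4) • g ≤ ∑ i ∈ s, g * b i * g := by
      have h4 := star_left_conjugate_le_conjugate h g
      have h5 : ∀ i, g * (p * b i * p) * g = g * b i * g := fun i => by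
        simp only [mul_assoc, hpg]
        rw [← mul_assoc g p, hgp]
      rw [sg, mul_smul_comm, smul_mul_assoc, hgp, hgg, Finset.sum_cons, mul_add, add_mul,
        Finset.mul_sum, Finset.sum_mul, h5] at h4
      simp only [h5] at h4
      have h6 := h4.trans (add_le_add_left h2 _)
      have h7 : ε • g = (ε / 4) • g + (ε / 2 + ε / 4) • g := by
        rw [← add_smul]; congr 1; ring
      rw [h7, add_comm] at h6
      exact le_of_add_le_add_left h6
    obtain ⟨F, hF1, hF2, hF3, ε', hε', hF4⟩ :=
      ih (fun i hi => hb i (by simp [hi])) hg (by positivity : 0 < ε / 4) h3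
    have hFg : ∀ i ∈ s, F i * g = F i := fun i hi => by
      rw [← hF3, Finset.mul_sum, Finset.sum_eq_single i]
      · exact (hF1 i hi).isIdempotentElem
      · exact fun k hk hki => hF2 i hi k hk hki.symm
      · exact fun h => (h hi).elim
    have hFf : ∀ i ∈ s, F i * f = 0 := fun i hi => by
      rw [← hFg i hi, mul_assoc, hgf0, mul_zero]
    have hfF : ∀ i ∈ s, f * F i = 0 := fun i hi => by
      simpa [hf.isSelfAdjoint.star_eq, (hF1 i hi).isSelfAdjoint.star_eq] using
        congrArg star (hFf i hi)
    have hne : ∀ i ∈ s, i ≠ j := by rintro i hi rfl; exact hj hi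
    refine ⟨Function.update F j f, ?_, ?_, ?_, min ε' (ε / 4), by positivity, ?_⟩
    · intro i hi
      rcases Finset.mem_cons.1 hi with rfl | hi
      · simpa using hf
      · simpa [hne i hi] using hF1 i hi
    · intro i hi k hk hik
      rcases Finset.mem_cons.1 hi with rfl | hi' <;> rcases Finset.mem_cons.1 hk with rfl | hk'
      · exact (hik rfl).elim
      · simpa [hne k hk'] using hfF k hk'
      · simpa [hne i hi'] using hFf i hi'
      · simpa [hne k hk', hne i hi'] using hF2 i hi' k hk' hik
    · rw [Finset.sum_cons, Function.update_self, ← hfg, ← hF3]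
      congr 1
      exact Finset.sum_congr rfl fun i hi => by simp [hne i hi]
    · intro i hi
      rcases Finset.mem_cons.1 hi with rfl | hi
      · rw [Function.update_self]
        refine le_trans (smul_le_smul_of_nonneg_right ?_ hf.nonneg) h1
        exact (min_le_right _ _).trans (by linarith)
      · rw [Function.update_of_ne (hne i hi)]
        exact le_trans (smul_le_smul_of_nonneg_right (min_le_left _ _) (hF1 i hi).nonneg)
          (hF4 i hi)

lemma exists_star_sum_mul_sum_le {ι : Type*} (s : Finset ι) (v w : ι → A) :
    ∃ C : ℝ, 0 < C ∧ star (∑ j ∈ s, w j * v j) * (∑ j ∈ s, w j * v j) ≤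
      C • ∑ j ∈ s, star (v j) * v j := by
  induction s using Finset.cons_induction with
  | empty => exact ⟨1, one_pos, by simp⟩
  | cons j s hj ih =>
    obtain ⟨C, hC, h⟩ := ih
    rw [Finset.sum_cons, Finset.sum_cons]
    set a := w j * v j
    set b := ∑ j ∈ s, w j * v j
    have h1 : star (a + b) * (a + b) ≤ (2 : ℝ) • (star a * a) + (2 : ℝ) • (star b * b) := by
      have h2 := star_mul_self_nonneg (a - b)
      rw [← sub_nonneg]
      convert h2 using 1
      simp only [two_smul, star_add, star_sub, add_mul, mul_add, sub_mul, mul_sub]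
      abel
    have h3 : star a * a ≤ ‖star (w j) * w j‖ • (star (v j) * v j) :=
      le_norm_smul_star_mul_self _ _
    have h4 : 0 ≤ ∑ j ∈ s, star (v j) * v j := Finset.sum_nonneg fun i _ => star_mul_self_nonneg _
    refine ⟨2 * ‖star (w j) * w j‖ + 2 * C, by positivity, h1.trans ?_⟩
    rw [smul_add]
    refine add_le_add ?_ ?_
    · refine (smul_le_smul_of_nonneg_left h3 zero_le_two).trans ?_
      rw [smul_smul]
      exact smul_le_smul_of_nonneg_right (by linarith) (star_mul_self_nonneg _)
    · refine (smul_le_smul_of_nonneg_left h zero_le_two).trans ?_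
      rw [smul_smul]
      exact smul_le_smul_of_nonneg_right (by linarith [norm_nonneg (star (w j) * w j)]) h4

namespace ProjMonoid

/-- Riesz decomposition of a projection which is subordinate to a sum of projections. -/
lemma exists_riesz (hsr1 : Dense {a : A | IsUnit a})
    (hrr0 : ∀ a : A, IsSelfAdjoint a → a ∈ closure {b : A | IsSelfAdjoint b ∧ IsUnit b})
    {p : A} (hp : IsStarProjection p) {m : ProjMonoid A} {J : Type} [Fintype J]
    {q : J → A} (hq : ∀ j, IsStarProjection (q j)) (h : cls p + m = ∑ j, cls (q j)) :
    ∃ e : J → A, (∀ j, IsStarProjection (e j)) ∧ (∀ j, q j * e j = e j) ∧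
      cls p = ∑ j, cls (e j) ∧ m = ∑ j, cls (q j - e j) := by
  obtain ⟨v, w, h1, h2, h3⟩ := exists_of_cls_add_eq_sum hp hq h
  obtain ⟨C, hC, h4⟩ := exists_star_sum_mul_sum_le Finset.univ v w
  rw [h1, hp.isSelfAdjoint.star_eq, hp.isIdempotentElem] at h4
  have h5 : C⁻¹ • p ≤ ∑ j, p * (star (v j) * v j) * p := by
    have h6 : ∀ j, p * (star (v j) * v j) * p = star (v j) * v j := fun j => by
      have : p * star (v j) = star (v j) := by
        simpa [hp.isSelfAdjoint.star_eq] using congrArg star (h3 j)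
      rw [mul_assoc, mul_assoc, h3, ← mul_assoc, this]
    simp only [h6]
    have := smul_le_smul_of_nonneg_left h4 (inv_nonneg.2 hC.le)
    rwa [smul_smul, inv_mul_cancel₀ hC.ne', one_smul] at this
  obtain ⟨f, hf1, hf2, hf3, ε, hε, hf4⟩ := hp.exists_riesz hrr0 Finset.univ
    (fun j => star (v j) * v j) (fun j _ => IsSelfAdjoint.star_mul_self _) (inv_pos.2 hC) h5
  have h7 : ∀ j, ∃ e, IsStarProjection e ∧ q j * e = e ∧ cls (f j) = cls e := fun j => by
    have hfj := hf1 j (Finset.mem_univ j)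
    refine hfj.exists_subprojection (x := v j * f j) (c := ε⁻¹) ?_ ?_ ?_
    · rw [← mul_assoc, h2]
    · rw [mul_assoc, hfj.isIdempotentElem]
    · have := smul_le_smul_of_nonneg_left (hf4 j (Finset.mem_univ j)) (inv_nonneg.2 hε.le)
      rw [smul_smul, inv_mul_cancel₀ hε.ne', one_smul] at this
      simpa only [star_mul, hfj.isSelfAdjoint.star_eq, mul_assoc] using this
  choose e he1 he2 he3 using h7
  have h8 : cls p = ∑ j, cls (e j) := by
    rw [← hf3, (cls_sum hf1 hf2).2]
    exact Finset.sum_congr rfl fun j _ => he3 j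
  refine ⟨e, he1, he2, h8, ?_⟩
  have h9 : ∀ j, cls (q j) = cls (e j) + cls (q j - e j) := fun j => by
    have h10 : e j * q j = e j := by
      simpa [(hq j).isSelfAdjoint.star_eq, (he1 j).isSelfAdjoint.star_eq] using
        congrArg star (he2 j)
    rw [← cls_add (he1 j) ((he1 j).sub_of_mul_eq_left (hq j) h10)
      (by rw [mul_sub, h10, (he1 j).isIdempotentElem, sub_self])]
    congr 1
    abel
  simp only [h9, Finset.sum_add_distrib, ← h8] at h
  exact add_left_cancel_of_dense hsr1 h

lemma exists_cls_refinement (hsr1 : Dense {a : A | IsUnit a})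
    (hrr0 : ∀ a : A, IsSelfAdjoint a → a ∈ closure {b : A | IsSelfAdjoint b ∧ IsUnit b})
    {p : A} (hp : IsStarProjection p) {m c d : ProjMonoid A}
    (h : cls p + m = c + d) : ∃ c₁ c₂ d₁ d₂, cls p = c₁ + d₁ ∧ m = c₂ + d₂ ∧ c = c₁ + c₂ ∧
      d = d₁ + d₂ := by
  obtain ⟨P, rfl⟩ : ∃ P, mk P = c := Quotient.exists_rep c
  obtain ⟨Q, rfl⟩ : ∃ P, mk P = d := Quotient.exists_rep d
  have h1 : cls p + m = ∑ j, cls ((P.sum Q).p j) := by rw [← mk_eq_sum, mk_sum, h]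
  obtain ⟨e, he1, he2, he3, he4⟩ := exists_riesz hsr1 hrr0 hp (P.sum Q).isStarProjection h1
  have h9 : ∀ j, cls ((P.sum Q).p j) = cls (e j) + cls ((P.sum Q).p j - e j) := fun j => by
    have h10 : e j * (P.sum Q).p j = e j := by
      simpa [((P.sum Q).isStarProjection j).isSelfAdjoint.star_eq,
        (he1 j).isSelfAdjoint.star_eq] using congrArg star (he2 j)
    rw [← cls_add (he1 j) ((he1 j).sub_of_mul_eq_left ((P.sum Q).isStarProjection j) h10)
      (by rw [mul_sub, h10, (he1 j).isIdempotentElem, sub_self])]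
    congr 1
    abel
  refine ⟨∑ i, cls (e (Sum.inl i)), ∑ i, cls (P.p i - e (Sum.inl i)),
    ∑ i, cls (e (Sum.inr i)), ∑ i, cls (Q.p i - e (Sum.inr i)), ?_, ?_, ?_, ?_⟩
  · rw [he3]; exact Fintype.sum_sum_type _
  · rw [he4]; exact Fintype.sum_sum_type _
  · rw [mk_eq_sum, ← Finset.sum_add_distrib]
    exact Finset.sum_congr rfl fun i _ => h9 (Sum.inl i)
  · rw [mk_eq_sum, ← Finset.sum_add_distrib]
    exact Finset.sum_congr rfl fun i _ => h9 (Sum.inr i)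

lemma exists_refinement (hsr1 : Dense {a : A | IsUnit a})
    (hrr0 : ∀ a : A, IsSelfAdjoint a → a ∈ closure {b : A | IsSelfAdjoint b ∧ IsUnit b})
    {a b c d : ProjMonoid A} (h : a + b = c + d) :
    ∃ z₁₁ z₁₂ z₂₁ z₂₂, a = z₁₁ + z₁₂ ∧ b = z₂₁ + z₂₂ ∧ c = z₁₁ + z₂₁ ∧ d = z₁₂ + z₂₂ := by
  induction a using ProjMonoid.induction_on generalizing c d with
  | zero => exact ⟨0, 0, c, d, by simp, by simpa using h, by simp, by simp⟩
  | cls_add p a hp ih =>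
    rw [add_assoc] at h
    obtain ⟨c₁, c₂, d₁, d₂, h1, h2, rfl, rfl⟩ := exists_cls_refinement hsr1 hrr0 hp h
    obtain ⟨z₁₁, z₁₂, z₂₁, z₂₂, rfl, rfl, rfl, rfl⟩ := ih h2
    exact ⟨c₁ + z₁₁, d₁ + z₁₂, z₂₁, z₂₂, by rw [h1]; abel, rfl, by abel, by abel⟩

lemma exists_subprojection_of_cls_eq (hsr1 : Dense {a : A | IsUnit a})
    (hrr0 : ∀ a : A, IsSelfAdjoint a → a ∈ closure {b : A | IsSelfAdjoint b ∧ IsUnit b})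
    {p : A} (hp : IsStarProjection p) {m n : ProjMonoid A}
    (h : cls p = m + n) :
    ∃ f, IsStarProjection f ∧ p * f = f ∧ f * p = f ∧ cls f = m ∧ cls (p - f) = n := by
  induction m using ProjMonoid.induction_on generalizing p with
  | zero => exact ⟨0, .zero A, by simp, by simp, by simp, by simpa using h⟩
  | cls_add r m hr ih =>
    rw [add_assoc] at h
    obtain ⟨e, he1, he2, he3, he4⟩ := exists_riesz hsr1 hrr0 hr (q := fun _ : Unit => p)
      (fun _ => hp) (m := m + n) (by simp [h])
    simp only [Finset.univ_unique, Finset.sum_singleton] at he3 he4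
    have hE := he1 default
    have hpE := he2 default
    set E := e default
    have hEp : E * p = E := by
      simpa [hE.isSelfAdjoint.star_eq, hp.isSelfAdjoint.star_eq] using congrArg star hpE
    have hpE' : IsStarProjection (p - E) := hE.sub_of_mul_eq_left hp hEp
    obtain ⟨f, hf1, hf2, hf3, hf4, hf5⟩ := ih hpE' he4.symm
    have hEf : E * f = 0 := by
      rw [← hf2, ← mul_assoc, mul_sub, hEp, hE.isIdempotentElem, sub_self, zero_mul]
    have hpf : p * f = f := by
      rw [← hf2, ← mul_assoc, mul_sub, hp.isIdempotentElem, hpE]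
    have hfp : f * p = f := by
      simpa [hf1.isSelfAdjoint.star_eq, hp.isSelfAdjoint.star_eq] using congrArg star hpf
    refine ⟨E + f, hE.add hf1 hEf, by rw [mul_add, hpE, hpf], by rw [add_mul, hEp, hfp], ?_, ?_⟩
    · rw [cls_add hE hf1 hEf, ← he3, hf4]
    · rw [← hf5]; congr 1; abel

lemma exists_subprojections_of_cls_eq_sum (hsr1 : Dense {a : A | IsUnit a})
    (hrr0 : ∀ a : A, IsSelfAdjoint a → a ∈ closure {b : A | IsSelfAdjoint b ∧ IsUnit b})
    {ι : Type*} (s : Finset ι) {p : A}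
    (hp : IsStarProjection p) {m : ι → ProjMonoid A} (h : cls p = ∑ j ∈ s, m j) :
    ∃ f : ι → A, (∀ j ∈ s, IsStarProjection (f j)) ∧
      (∀ i ∈ s, ∀ j ∈ s, i ≠ j → f i * f j = 0) ∧ ∑ j ∈ s, f j = p ∧
      ∀ j ∈ s, cls (f j) = m j := by
  classical
  induction s using Finset.cons_induction generalizing p with
  | empty =>
    refine ⟨0, by simp, by simp, ?_, by simp⟩
    simpa using ((cls_eq_zero_iff hp).1 (by simpa using h)).symm
  | cons j s hj ih =>
    rw [Finset.sum_cons] at h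
    obtain ⟨f, hf, hpf, hfp, hfm, hfn⟩ := exists_subprojection_of_cls_eq hsr1 hrr0 hp h
    have hg : IsStarProjection (p - f) := hf.sub_of_mul_eq_left hp hfp
    have hgf0 : (p - f) * f = 0 := by rw [sub_mul, hpf, hf.isIdempotentElem, sub_self]
    obtain ⟨F, hF1, hF2, hF3, hF4⟩ := ih hg hfn
    have hFg : ∀ i ∈ s, F i * (p - f) = F i := fun i hi => by
      rw [← hF3, Finset.mul_sum, Finset.sum_eq_single i]
      · exact (hF1 i hi).isIdempotentElem
      · exact fun k hk hki => hF2 i hi k hk hki.symm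
      · exact fun h => (h hi).elim
    have hFf : ∀ i ∈ s, F i * f = 0 := fun i hi => by
      rw [← hFg i hi, mul_assoc, hgf0, mul_zero]
    have hfF : ∀ i ∈ s, f * F i = 0 := fun i hi => by
      simpa [hf.isSelfAdjoint.star_eq, (hF1 i hi).isSelfAdjoint.star_eq] using
        congrArg star (hFf i hi)
    have hne : ∀ i ∈ s, i ≠ j := by rintro i hi rfl; exact hj hi
    refine ⟨Function.update F j f, ?_, ?_, ?_, ?_⟩
    · intro i hi
      rcases Finset.mem_cons.1 hi with rfl | hi
      · simpa using hf
      · simpa [hne i hi] using hF1 i hi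
    · intro i hi k hk hik
      rcases Finset.mem_cons.1 hi with rfl | hi' <;> rcases Finset.mem_cons.1 hk with rfl | hk'
      · exact (hik rfl).elim
      · simpa [hne k hk'] using hfF k hk'
      · simpa [hne i hi'] using hFf i hi'
      · simpa [hne k hk', hne i hi'] using hF2 i hi' k hk' hik
    · rw [Finset.sum_cons, Function.update_self, Finset.sum_congr rfl
        fun i hi => Function.update_of_ne (hne i hi) f F, hF3]
      abel
    · intro i hi
      rcases Finset.mem_cons.1 hi with rfl | hi
      · simpa using hfm
      · simpa [hne i hi] using hF4 i hi

end ProjMonoid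

end Riesz

section Matching

open ProjMonoid

variable {A : Type*} [CStarAlgebra A]

lemma norm_sum_smul_le {T : Type*} [Fintype T] {b : T → A} (hb : ∀ t, IsStarProjection (b t))
    (horth : ∀ s t, s ≠ t → b s * b t = 0) {l : T → ℂ} {η : ℝ} (hη : 0 ≤ η)
    (hl : ∀ t, ‖l t‖ ≤ η) : ‖∑ t, l t • b t‖ ≤ η := by
  classical
  let := CStarAlgebra.spectralOrder A
  have := CStarAlgebra.spectralOrderedRing A
  have h1 : star (∑ t, l t • b t) * (∑ t, l t • b t) = ∑ t, (‖l t‖ ^ 2) • b t := by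
    rw [star_sum, Finset.sum_mul]
    refine Finset.sum_congr rfl fun t _ => ?_
    rw [Finset.mul_sum, Finset.sum_eq_single t]
    · rw [star_smul, (hb t).isSelfAdjoint.star_eq, smul_mul_smul_comm, (hb t).isIdempotentElem,
        ← Complex.coe_smul, RCLike.star_def, Complex.conj_mul', Complex.ofReal_pow]
    · intro s _ hs
      rw [star_smul, (hb t).isSelfAdjoint.star_eq, smul_mul_smul_comm, horth _ _ hs.symm, smul_zero]
    · simp
  have h2 : ∑ t, (‖l t‖ ^ 2) • b t ≤ (η ^ 2) • ∑ t, b t := by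
    rw [Finset.smul_sum]
    refine Finset.sum_le_sum fun t _ => smul_le_smul_of_nonneg_right ?_ (hb t).nonneg
    exact pow_le_pow_left₀ (norm_nonneg _) (hl t) 2
  have h3 : IsStarProjection (∑ t, b t) :=
    (cls_sum (fun t _ => hb t) (fun s _ t _ => horth s t)).1
  have h4 : ‖∑ t, l t • b t‖ ^ 2 ≤ η ^ 2 := by
    rw [sq, ← CStarRing.norm_star_mul_self]
    refine (CStarAlgebra.norm_le_norm_of_nonneg_of_le (star_mul_self_nonneg _)
      (h1.le.trans h2)).trans ?_
    rw [norm_smul, Real.norm_of_nonneg (sq_nonneg η)]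
    exact mul_le_of_le_one_right (sq_nonneg η) (IsStarProjection.norm_le _ h3)
  exact le_of_sq_le_sq h4 hη

/-- A strictly positive element has a selfadjoint inverse square root commuting with everything
that commutes with it. -/
lemma exists_inv_sqrt [PartialOrder A] [StarOrderedRing A] {h : A} (hh : IsStrictlyPositive h) :
    ∃ k, IsSelfAdjoint k ∧ k * h * k = 1 ∧ IsUnit k ∧ ∀ a, Commute h a → Commute k a := by
  have h1 := CFC.conjugate_rpow_neg_one_half h hh
  have hc : ∀ a, Commute h a → Commute (h ^ (-(1 / 2 : ℝ))) a := fun a ha => by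
    rw [CFC.rpow_def]
    exact Commute.cfc_nnreal ha _
  have h2 : h ^ (-(1 / 2 : ℝ)) * h = h * h ^ (-(1 / 2 : ℝ)) := hc h (Commute.refl h)
  refine ⟨h ^ (-(1 / 2 : ℝ)), IsSelfAdjoint.of_nonneg CFC.rpow_nonneg, h1, ?_, hc⟩
  refine isUnit_iff_exists.2 ⟨h * h ^ (-(1 / 2 : ℝ)), ?_, ?_⟩
  · rw [← mul_assoc, h1]
  · rw [← h2, h1]

lemma exists_unitary_of_isUnit {T : Type*} {u : A} (hu : IsUnit u) {a b : T → A}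
    (ha : ∀ t, IsSelfAdjoint (a t)) (hb : ∀ t, IsSelfAdjoint (b t))
    (h : ∀ t, u * a t = b t * u) : ∃ U ∈ unitary A, ∀ t, U * a t * star U = b t := by
  let := CStarAlgebra.spectralOrder A
  have := CStarAlgebra.spectralOrderedRing A
  have hp : IsStrictlyPositive (star u * u) :=
    (hu.star.mul hu).isStrictlyPositive (star_mul_self_nonneg u)
  obtain ⟨k, hk, h1, hku, hc⟩ := exists_inv_sqrt hp
  have h2 : star (u * k) * (u * k) = 1 := by
    rw [star_mul, hk.star_eq, ← h1]; simp only [mul_assoc]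
  have h3 : (u * k) * star (u * k) = 1 := by
    obtain ⟨v, hv⟩ := hu.mul hku
    rw [← hv] at h2 ⊢
    have : star (v : A) = ((v⁻¹ : Aˣ) : A) := by
      rw [← mul_one (star (v : A)), ← v.mul_inv, ← mul_assoc, h2, one_mul]
    rw [this, v.mul_inv]
  refine ⟨u * k, ⟨h2, h3⟩, fun t => ?_⟩
  have h4 : star u * b t = a t * star u := by
    simpa [(ha t).star_eq, (hb t).star_eq] using (congrArg star (h t)).symm
  have h5 : k * a t = a t * k := by
    refine hc _ ?_
    change star u * u * a t = a t * (star u * u)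
    rw [mul_assoc, h, ← mul_assoc, h4, mul_assoc]
  calc u * k * a t * star (u * k) = u * (k * a t) * star (u * k) := by simp only [mul_assoc]
    _ = b t * (u * k * star (u * k)) := by rw [h5]; simp only [← mul_assoc, h]
    _ = b t := by rw [h3, mul_one]

/-- Equivalent partitions of the unit are unitarily equivalent. -/
lemma exists_unitary_of_cls_eq {T : Type*} [Fintype T] {a b : T → A}
    (ha : ∀ t, IsStarProjection (a t)) (hb : ∀ t, IsStarProjection (b t))
    (ha' : ∀ s t, s ≠ t → a s * a t = 0) (hb' : ∀ s t, s ≠ t → b s * b t = 0)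
    (ha1 : ∑ t, a t = 1) (hb1 : ∑ t, b t = 1) (h : ∀ t, cls (a t) = cls (b t)) :
    ∃ U ∈ unitary A, ∀ t, U * a t * star U = b t := by
  classical
  have h1 := fun t => (cls_eq_cls_iff (ha t) (hb t)).1 (h t)
  choose x y hyx hxy hx hy using h1
  have hbx : ∀ t, b t * x t = x t := fun t => by rw [← hxy, mul_assoc, hyx, hx]
  have hay : ∀ t, a t * y t = y t := fun t => by rw [← hyx, mul_assoc, hxy, hy]
  have key : ∀ {a b x y : T → A}, (∀ t, y t * x t = a t) → (∀ t, y t * b t = y t) →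
      (∀ t, b t * x t = x t) → (∀ s t, s ≠ t → b s * b t = 0) →
      (∑ t, y t) * (∑ t, x t) = ∑ t, a t := by
    intro a b x y hyx hy hbx hb'
    rw [Finset.sum_mul]
    refine Finset.sum_congr rfl fun t _ => ?_
    rw [Finset.mul_sum, Finset.sum_eq_single t, hyx]
    · intro s _ hs
      rw [← hy, ← hbx s, mul_assoc, ← mul_assoc (b t), hb' t s hs.symm, zero_mul, mul_zero]
    · simp
  have hu : IsUnit (∑ t, x t) := by
    refine isUnit_iff_exists.2 ⟨∑ t, y t, ?_, ?_⟩
    · rw [key hxy hx hay ha', hb1]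
    · rw [key hyx hy hbx hb', ha1]
  refine exists_unitary_of_isUnit hu (fun t => (ha t).isSelfAdjoint)
    (fun t => (hb t).isSelfAdjoint) fun t => ?_
  rw [Finset.sum_mul, Finset.mul_sum, Finset.sum_eq_single t, Finset.sum_eq_single t, hx, hbx]
  · intro s _ hs
    rw [← hbx s, ← mul_assoc, hb' t s hs.symm, zero_mul]
  · simp
  · intro s _ hs
    rw [← hx s, mul_assoc, ha' s t hs, mul_zero]
  · simp

lemma refine_partition {I J : Type*} [Fintype I] [Fintype J] {p : I → A} {a : I → J → A}
    (hp : ∀ i, IsStarProjection (p i)) (hp' : ∀ i j, i ≠ j → p i * p j = 0)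
    (ha : ∀ i j, IsStarProjection (a i j)) (ha' : ∀ i j k, j ≠ k → a i j * a i k = 0)
    (h : ∀ i, ∑ j, a i j = p i) (i j k l) (hne : (i, j) ≠ (k, l)) : a i j * a k l = 0 := by
  classical
  have h1 : ∀ i j, a i j * p i = a i j := fun i j => by
    rw [← h, Finset.mul_sum, Finset.sum_eq_single j, (ha i j).isIdempotentElem]
    · exact fun k _ hk => ha' i j k hk.symm
    · simp
  have h2 : ∀ i j, p i * a i j = a i j := fun i j => by
    simpa [(hp i).isSelfAdjoint.star_eq, (ha i j).isSelfAdjoint.star_eq] using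
      congrArg star (h1 i j)
  by_cases hik : i = k
  · subst hik
    exact ha' i j l (by rintro rfl; exact hne rfl)
  · rw [← h1, ← h2 k, mul_assoc, ← mul_assoc (p i), hp' i k hik, zero_mul, mul_zero]

/-- A matching theorem for partitions of the unit into projections. -/
lemma exists_unitary_matching (hsr1 : Dense {a : A | IsUnit a})
    (hrr0 : ∀ a : A, IsSelfAdjoint a → a ∈ closure {b : A | IsSelfAdjoint b ∧ IsUnit b})
    {I J : Type} [Fintype I] [Fintype J] [DecidableEq I] [DecidableEq J]
    {p : I → A} {q : J → A} (hp : ∀ i, IsStarProjection (p i)) (hq : ∀ j, IsStarProjection (q j))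
    (hp' : ∀ i j, i ≠ j → p i * p j = 0) (hq' : ∀ i j, i ≠ j → q i * q j = 0)
    (hp1 : ∑ i, p i = 1) (hq1 : ∑ j, q j = 1) (E : Finset (I × J))
    (hE : ∀ (S : Finset I) (T : Finset J), (∀ e ∈ E, e.1 ∈ S → e.2 ∈ T) →
      ∃ m, cls (∑ i ∈ S, p i) + m = cls (∑ j ∈ T, q j)) :
    ∃ U ∈ unitary A, ∃ b : I × J → A, (∀ t, IsStarProjection (b t)) ∧
      (∀ s t, s ≠ t → b s * b t = 0) ∧ (∀ t ∉ E, b t = 0) ∧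
      (∀ i, U * p i * star U = ∑ j, b (i, j)) ∧ ∀ j, q j = ∑ i, b (i, j) := by
  let := CStarAlgebra.spectralOrder A
  have := CStarAlgebra.spectralOrderedRing A
  have hcan : ∀ l m n : ProjMonoid A, l + m = l + n → m = n := fun l m n h =>
    add_left_cancel_of_dense hsr1 h
  have : IsCancelAdd (ProjMonoid A) :=
    { add_left_cancel := fun l m n h => hcan l m n h
      add_right_cancel := fun l m n h => hcan l m n (by
        have h' : m + l = n + l := h
        rwa [add_comm m, add_comm n] at h') }
  let φ : ProjMonoid A →+ Algebra.GrothendieckAddGroup (ProjMonoid A) :=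
    Algebra.GrothendieckAddGroup.of
  have hφ : Function.Injective φ := Algebra.GrothendieckAddGroup.of_injective
  have hC : ConeRefinement (AddMonoidHom.mrange φ) := by
    rintro _ ⟨a, rfl⟩ _ ⟨b, rfl⟩ _ ⟨c, rfl⟩ _ ⟨d, rfl⟩ h
    rw [← map_add, ← map_add] at h
    obtain ⟨z₁₁, z₁₂, z₂₁, z₂₂, rfl, rfl, rfl, rfl⟩ := exists_refinement hsr1 hrr0 (hφ h)
    exact ⟨_, ⟨z₁₁, rfl⟩, _, ⟨z₁₂, rfl⟩, _, ⟨z₂₁, rfl⟩, _, ⟨z₂₂, rfl⟩, map_add φ _ _, map_add φ _ _,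
      map_add φ _ _, map_add φ _ _⟩
  have hcon : ∀ a ∈ AddMonoidHom.mrange φ, -a ∈ AddMonoidHom.mrange φ → a = 0 := by
    rintro _ ⟨a, rfl⟩ ⟨b, hb⟩
    have : φ (a + b) = φ 0 := by rw [map_add, hb, map_zero, add_neg_cancel]
    rw [eq_zero_of_add_eq_zero (hφ this), map_zero]
  have sump : ∀ S : Finset I, cls (∑ i ∈ S, p i) = ∑ i ∈ S, cls (p i) := fun S =>
    (cls_sum (fun i _ => hp i) fun i _ j _ => hp' i j).2
  have sumq : ∀ S : Finset J, cls (∑ i ∈ S, q i) = ∑ i ∈ S, cls (q i) := fun S =>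
    (cls_sum (fun i _ => hq i) fun i _ j _ => hq' i j).2
  obtain ⟨z, hzC, hz0, hzp, hzq⟩ := hC.hall hcon E (fun i => φ (cls (p i)))
    (fun j => φ (cls (q j))) (by
      rw [← map_sum, ← map_sum, ← sump, ← sumq, hp1, hq1]) (by
      intro S T hST
      obtain ⟨m, hm⟩ := hE S T hST
      refine ⟨m, ?_⟩
      rw [← map_sum, ← map_sum, ← sump, ← sumq, ← hm, map_add, add_sub_cancel_left])
  choose ζ hζ using hzC
  have hp2 : ∀ i, cls (p i) = ∑ j, ζ i j := fun i => hφ (by rw [map_sum, ← hzp]; simp only [hζ])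
  have hq2 : ∀ j, cls (q j) = ∑ i, ζ i j := fun j => hφ (by rw [map_sum, ← hzq]; simp only [hζ])
  have hap := fun i => exists_subprojections_of_cls_eq_sum hsr1 hrr0 Finset.univ (hp i) (hp2 i)
  have hbq := fun j => exists_subprojections_of_cls_eq_sum hsr1 hrr0 Finset.univ (hq j) (hq2 j)
  choose a ha1 ha2 ha3 ha4 using hap
  choose b hb1 hb2 hb3 hb4 using hbq
  have hb : ∀ t : I × J, IsStarProjection (b t.2 t.1) := fun t => hb1 _ _ (Finset.mem_univ _)
  have hborth : ∀ s t : I × J, s ≠ t → b s.2 s.1 * b t.2 t.1 = 0 := fun s t hst =>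
    refine_partition hq hq' (fun j i => hb1 j i (Finset.mem_univ _))
      (fun j i k hik => hb2 j i (Finset.mem_univ _) k (Finset.mem_univ _) hik) hb3 _ _ _ _
      (fun h => hst (by
        rw [Prod.mk.injEq] at h
        exact Prod.ext h.2 h.1))
  obtain ⟨U, hU, hUab⟩ := exists_unitary_of_cls_eq (T := I × J) (a := fun t => a t.1 t.2)
    (b := fun t => b t.2 t.1) (fun t => ha1 _ _ (Finset.mem_univ _)) hb
    (fun s t hst => refine_partition hp hp' (fun i j => ha1 i j (Finset.mem_univ _))
      (fun i j k hjk => ha2 i j (Finset.mem_univ _) k (Finset.mem_univ _) hjk) ha3 _ _ _ _ hst)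
    hborth
    (by rw [Fintype.sum_prod_type]; simp only [ha3, hp1])
    (by rw [Fintype.sum_prod_type_right]; simp only [hb3, hq1])
    (fun t => by rw [ha4 _ _ (Finset.mem_univ _), hb4 _ _ (Finset.mem_univ _)])
  refine ⟨U, hU, fun t => b t.2 t.1, hb, hborth, ?_, ?_, fun j => (hb3 j).symm⟩
  · rintro ⟨i, j⟩ ht
    rw [← cls_eq_zero_iff (hb (i, j)), hb4 _ _ (Finset.mem_univ _)]
    exact hφ (by rw [hζ, hz0 i j ht, map_zero])
  · intro i
    rw [← ha3, Finset.mul_sum, Finset.sum_mul]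
    exact Finset.sum_congr rfl fun j _ => hUab (i, j)

end Matching

section FiniteRange

variable {A : Type*} [CStarAlgebra A]

/-- An element of a finite-dimensional subalgebra has finite spectrum. -/
lemma finite_spectrum_of_finiteDimensional_range {Ω : Set ℂ} (φ : C(Ω, ℂ) →⋆ₐ[ℂ] A)
    (h : ∃ V : Submodule ℂ A, FiniteDimensional ℂ V ∧ Set.range φ ⊆ (V : Set A)) (f : C(Ω, ℂ)) :
    (spectrum ℂ (φ f)).Finite := by
  obtain ⟨V, hV, hφ⟩ := h
  have h1 : φ.toAlgHom.range.toSubmodule ≤ V := by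
    rintro _ ⟨g, rfl⟩
    exact hφ ⟨g, rfl⟩
  have h2 : φ.toAlgHom.range.toSubmodule.FG := by
    have := Submodule.finiteDimensional_of_le h1
    exact Module.Finite.iff_fg.1 this
  obtain ⟨P, hP, hP0⟩ := IsIntegral.of_mem_of_fg φ.toAlgHom.range h2 (φ f) ⟨f, rfl⟩
  refine (Multiset.finite_toSet P.roots).subset fun z hz => ?_
  have h3 := spectrum.subset_polynomial_aeval (φ f) P ⟨z, hz, rfl⟩
  rw [Polynomial.aeval_def, hP0] at h3
  have : Nontrivial A := by
    by_contra hn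
    rw [not_nontrivial_iff_subsingleton] at hn
    simp at hz
  rw [spectrum.zero_eq] at h3
  exact (Polynomial.mem_roots hP.ne_zero).2 h3

/-- A unital `*`-homomorphism with finite-dimensional range is a sum of point evaluations. -/
lemma exists_projections_of_finiteDimensional_range {Ω : Set ℂ} (hΩ : IsCompact Ω)
    (φ : C(Ω, ℂ) →⋆ₐ[ℂ] A)
    (h : ∃ V : Submodule ℂ A, FiniteDimensional ℂ V ∧ Set.range φ ⊆ (V : Set A)) :
    ∃ (I : Type) (_ : Fintype I) (_ : DecidableEq I) (x : I → Ω) (p : I → A),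
      (∀ i, IsStarProjection (p i)) ∧ (∀ i j, i ≠ j → p i * p j = 0) ∧ ∑ i, p i = 1 ∧
      ∀ f, φ f = ∑ i, f (x i) • p i := by
  classical
  have : CompactSpace Ω := isCompact_iff_compactSpace.1 hΩ
  let X : C(Ω, ℂ) := ⟨Subtype.val, continuous_subtype_val⟩
  have hfin := finite_spectrum_of_finiteDimensional_range φ h X
  have hsub : ∀ z ∈ spectrum ℂ (φ X), z ∈ Ω := by
    intro z hz
    have h1 := AlgHom.spectrum_apply_subset φ X hz
    rw [ContinuousMap.spectrum_eq_range] at h1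
    obtain ⟨y, rfl⟩ := h1
    exact y.2
  have hn : IsStarNormal (φ X) := by
    refine ⟨?_⟩
    rw [← map_star]
    exact (Commute.all (star X) X).map φ
  have : Finite (spectrum ℂ (φ X)) := hfin
  have : Fintype (spectrum ℂ (φ X)) := Fintype.ofFinite _
  let ι : C(spectrum ℂ (φ X), Ω) := ⟨fun z => ⟨z, hsub z z.2⟩, by fun_prop⟩
  let θ := cfcHom (R := ℂ) (p := IsStarNormal) hn
  have hθ : φ = θ.comp (ContinuousMap.compStarAlgHom' ℂ ℂ ι) := by
    refine ContinuousMap.starAlgHom_ext_map_X ?_ ?_ ?_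
    · exact AddMonoidHomClass.continuous_of_bound φ 1
        (by simpa using NonUnitalStarAlgHom.norm_apply_le φ)
    · exact (cfcHom_continuous hn).comp (ContinuousMap.continuous_precomp ι)
    · have h1 : Polynomial.toContinuousMapOnAlgHom Ω Polynomial.X = X := by
        ext z; simp [X]
      rw [h1]
      refine (cfcHom_id (R := ℂ) (p := IsStarNormal) hn).symm.trans ?_
      rfl
  let δ : spectrum ℂ (φ X) → C(spectrum ℂ (φ X), ℂ) := fun z =>
    ⟨fun w => if w = z then 1 else 0, continuous_of_discreteTopology⟩
  refine ⟨spectrum ℂ (φ X), inferInstance, inferInstance, ι, fun z => θ (δ z), ?_, ?_, ?_, ?_⟩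
  · intro z
    refine ⟨?_, ?_⟩
    · rw [IsIdempotentElem, ← map_mul]
      congr 1
      ext w
      simp [δ]
    · rw [IsSelfAdjoint, ← map_star]
      congr 1
      ext w
      by_cases hw : w = z <;> simp [δ, hw]
  · intro z w hzw
    rw [← map_mul, ← map_zero θ]
    congr 1
    ext v
    by_cases hv : v = z
    · subst hv; simp [δ, hzw]
    · simp [δ, hv]
  · rw [← map_sum, ← map_one θ]
    congr 1
    ext v
    simp [δ]
  · intro f
    conv_lhs => rw [hθ]
    simp only [← map_smul]
    rw [← map_sum]
    change θ _ = θ _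
    congr 1
    ext v
    simp [δ]

end FiniteRange

section Bump

lemma fO_apply_eq {Ω O : Set ℂ} (x : Ω) :
    ∃ t : ℝ, 0 ≤ t ∧ t ≤ 1 ∧ fO Ω O x = (t : ℂ) :=
  ⟨_, ENNReal.toReal_nonneg, ENNReal.toReal_le_of_le_ofReal zero_le_one (by simp), rfl⟩

lemma fO_apply_eq_zero_iff {Ω O : Set ℂ} (hO : RelOpen Ω O) (x : Ω) :
    fO Ω O x = 0 ↔ (x : ℂ) ∉ O := by
  have h1 : fO Ω O x = 0 ↔ Metric.infEDist (x : ℂ) (Ω \ O) = 0 := by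
    change (((min 1 (Metric.infEDist (x : ℂ) (Ω \ O))).toReal : ℝ) : ℂ) = 0 ↔ _
    rw [Complex.ofReal_eq_zero, ENNReal.toReal_eq_zero_iff,
      or_iff_left (ne_top_of_le_ne_top ENNReal.one_ne_top (min_le_left _ _)), min_eq_iff]
    simp +contextual
  rw [h1]
  refine ⟨fun h hx => ?_, fun h => Metric.infEDist_zero_of_mem ⟨x.2, h⟩⟩
  obtain ⟨U, hU, rfl⟩ := hO
  have h2 : Ω \ (U ∩ Ω) ⊆ Uᶜ := fun z hz hzU => hz.2 ⟨hzU, hz.1⟩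
  exact closure_minimal h2 hU.isClosed_compl (Metric.mem_closure_iff_infEDist_zero.2 h) hx.1

lemma relOpen_thicken (Ω O : Set ℂ) (r : ℝ) : RelOpen Ω (thicken Ω O r) :=
  ⟨{x | Metric.infDist x O < r}, isOpen_lt (Metric.continuous_infDist_pt O) continuous_const,
    Set.ext fun _ => and_comm⟩

end Bump

section UnitaryMatching

variable {A : Type*} [CStarAlgebra A]

lemma IsStarProjection.exists_subprojection_of_cuntzLE {P Q a c h : A} (hP : IsStarProjection P)
    (hQ : IsStarProjection Q) (hac : CuntzLE a c) (hah : a * h = P) (hQc : Q * c = c) :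
    ∃ e, IsStarProjection e ∧ Q * e = e ∧ ProjMonoid.cls P = ProjMonoid.cls e := by
  let := CStarAlgebra.spectralOrder A
  have := CStarAlgebra.spectralOrderedRing A
  obtain ⟨r, hr⟩ := hac
  have h1 : Tendsto (fun n => ‖star (r n) * c * r n - a‖ * ‖h‖) atTop (nhds 0) := by
    simpa using hr.mul_const ‖h‖
  obtain ⟨n, hn⟩ := (h1.eventually (gt_mem_nhds zero_lt_one)).exists
  refine hP.exists_subprojection_of_norm_lt (b := star (r n)) (c := c * r n * h) hQ ?_
  have hPP : P * P = P := hP.isIdempotentElem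
  have e : P - P * star (r n) * Q * (c * r n * h) * P
      = -(P * ((star (r n) * c * r n - a) * h) * P) := by
    have e1 : P * star (r n) * Q * (c * r n * h) * P = P * star (r n) * (Q * c) * r n * h * P := by
      simp only [mul_assoc]
    rw [e1, hQc, sub_mul, hah, mul_sub, sub_mul, hPP, hPP]
    simp only [mul_assoc]
    abel
  have hP1 := IsStarProjection.norm_le P hP
  rw [e, norm_neg]
  calc ‖P * ((star (r n) * c * r n - a) * h) * P‖
      ≤ ‖P‖ * ‖(star (r n) * c * r n - a) * h‖ * ‖P‖ := norm_mul₃_le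
    _ ≤ 1 * ‖(star (r n) * c * r n - a) * h‖ * 1 := by gcongr
    _ ≤ ‖star (r n) * c * r n - a‖ * ‖h‖ := by rw [one_mul, mul_one]; exact norm_mul_le _ _
    _ < 1 := hn

/-- If `φ (f_O) ≾ ψ (f_{O_r})` for all relatively open `O`, then `φ` and `ψ` are, up to a unitary,
uniformly close on functions with small oscillation at scale `ε > r`. -/
lemma exists_unitary_of_cuntzLE (hsr1 : Dense {a : A | IsUnit a})
    (hrr0 : ∀ a : A, IsSelfAdjoint a → a ∈ closure {b : A | IsSelfAdjoint b ∧ IsUnit b})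
    {Ω : Set ℂ} (hΩ : IsCompact Ω) {φ ψ : C(Ω, ℂ) →⋆ₐ[ℂ] A}
    (hφ : ∃ V : Submodule ℂ A, FiniteDimensional ℂ V ∧ Set.range φ ⊆ (V : Set A))
    (hψ : ∃ V : Submodule ℂ A, FiniteDimensional ℂ V ∧ Set.range ψ ⊆ (V : Set A))
    {r ε : ℝ} (hrε : r < ε)
    (hle : ∀ O, RelOpen Ω O → CuntzLE (φ (fO Ω O)) (ψ (fO Ω (thicken Ω O r)))) :
    ∃ U ∈ unitary A, ∀ (f : C(Ω, ℂ)) (η : ℝ), 0 ≤ η →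
      (∀ x y : Ω, dist x y < ε → ‖f x - f y‖ ≤ η) → ‖U * φ f * star U - ψ f‖ ≤ η := by
  classical
  obtain ⟨I, _, _, x, p, hp, hp', hp1, hφp⟩ := exists_projections_of_finiteDimensional_range hΩ φ hφ
  obtain ⟨J, _, _, y, q, hq, hq', hq1, hψq⟩ := exists_projections_of_finiteDimensional_range hΩ ψ hψ
  let E : Finset (I × J) := Finset.univ.filter fun t => dist (x t.1) (y t.2) < ε
  have hE : ∀ (S : Finset I) (T : Finset J), (∀ e ∈ E, e.1 ∈ S → e.2 ∈ T) →
      ∃ m, ProjMonoid.cls (∑ i ∈ S, p i) + m = ProjMonoid.cls (∑ j ∈ T, q j) := by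
    intro S T hST
    have hP : IsStarProjection (∑ i ∈ S, p i) :=
      (ProjMonoid.cls_sum (fun i _ => hp i) (fun i _ j _ => hp' i j)).1
    have hQ : IsStarProjection (∑ j ∈ T, q j) :=
      (ProjMonoid.cls_sum (fun i _ => hq i) (fun i _ j _ => hq' i j)).1
    suffices h : ∃ e, IsStarProjection e ∧ (∑ j ∈ T, q j) * e = e ∧
        ProjMonoid.cls (∑ i ∈ S, p i) = ProjMonoid.cls e by
      obtain ⟨e, he, hQe, hPe⟩ := h
      have heQ : e * (∑ j ∈ T, q j) = e := by
        simpa [star_mul, he.isSelfAdjoint.star_eq, hQ.isSelfAdjoint.star_eq] using congrArg star hQe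
      refine ⟨ProjMonoid.cls ((∑ j ∈ T, q j) - e), ?_⟩
      rw [hPe, ← ProjMonoid.cls_add he (he.sub_of_mul_eq_left hQ heQ)]
      · rw [add_sub_cancel]
      · rw [mul_sub, heQ, he.isIdempotentElem, sub_self]
    rcases S.eq_empty_or_nonempty with rfl | ⟨i₀, hi₀⟩
    · exact ⟨0, .zero A, by simp, by simp⟩
    let O : Set ℂ := (⋃ i ∈ S, Metric.ball (x i : ℂ) (ε - r)) ∩ Ω
    have hO : RelOpen Ω O :=
      ⟨_, isOpen_biUnion fun _ _ => Metric.isOpen_ball, rfl⟩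
    have hxO : ∀ i ∈ S, (x i : ℂ) ∈ O := fun i hi =>
      ⟨Set.mem_biUnion (x := i) hi (Metric.mem_ball_self (sub_pos.2 hrε)), (x i).2⟩
    refine hP.exists_subprojection_of_cuntzLE
      (h := ∑ i ∈ S, (fO Ω O (x i))⁻¹ • p i) hQ (hle O hO) ?_ ?_
    · rw [hφp, Finset.mul_sum]
      refine Finset.sum_congr rfl fun i hi => ?_
      have h0 : fO Ω O (x i) ≠ 0 := fun h => (fO_apply_eq_zero_iff hO (x i)).1 h (hxO i hi)
      rw [Finset.sum_mul, Finset.sum_eq_single i]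
      · rw [smul_mul_smul_comm, mul_inv_cancel₀ h0, (hp i).isIdempotentElem, one_smul]
      · intro k _ hk
        rw [smul_mul_smul_comm, hp' _ _ hk, smul_zero]
      · simp
    · rw [hψq, Finset.mul_sum]
      refine Finset.sum_congr rfl fun j _ => ?_
      by_cases hj : j ∈ T
      · rw [Finset.sum_mul, Finset.sum_eq_single j]
        · rw [mul_smul_comm, (hq j).isIdempotentElem]
        · intro k _ hk
          rw [mul_smul_comm, hq' _ _ hk, smul_zero]
        · exact fun h => absurd hj h
      · have h0 : fO Ω (thicken Ω O r) (y j) = 0 := by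
          rw [fO_apply_eq_zero_iff (relOpen_thicken Ω O r)]
          rintro ⟨_, h⟩
          obtain ⟨z, hz, hyz⟩ := (Metric.infDist_lt_iff ⟨_, hxO i₀ hi₀⟩).1 h
          obtain ⟨i, hi, hzi⟩ := Set.mem_iUnion₂.1 hz.1
          refine hj (hST (i, j) ?_ hi)
          simp only [E, Finset.mem_filter_univ]
          rw [Metric.mem_ball, dist_comm] at hzi
          rw [dist_comm] at hyz
          have := dist_triangle (x i : ℂ) z (y j)
          change dist (x i : ℂ) (y j) < ε
          linarith
        rw [h0, zero_smul, mul_zero]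
  obtain ⟨U, hU, b, hb, hb', hbE, hpb, hqb⟩ :=
    exists_unitary_matching hsr1 hrr0 hp hq hp' hq' hp1 hq1 E hE
  refine ⟨U, hU, fun f η hη hf => ?_⟩
  have h1 : U * φ f * star U - ψ f =
      ∑ t : I × J, (if t ∈ E then f (x t.1) - f (y t.2) else 0) • b t := by
    rw [hφp, hψq, Finset.mul_sum, Finset.sum_mul]
    have e1 : ∑ i, U * f (x i) • p i * star U = ∑ t : I × J, f (x t.1) • b t := by
      rw [Fintype.sum_prod_type]
      refine Finset.sum_congr rfl fun i _ => ?_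
      rw [mul_smul_comm, smul_mul_assoc, hpb, Finset.smul_sum]
    have e2 : ∑ j, f (y j) • q j = ∑ t : I × J, f (y t.2) • b t := by
      rw [Fintype.sum_prod_type_right]
      refine Finset.sum_congr rfl fun j _ => ?_
      rw [hqb, Finset.smul_sum]
    rw [e1, e2, ← Finset.sum_sub_distrib]
    refine Finset.sum_congr rfl fun t _ => ?_
    by_cases ht : t ∈ E
    · rw [if_pos ht, sub_smul]
    · rw [if_neg ht, hbE t ht, smul_zero, smul_zero, smul_zero, sub_zero]
  rw [h1]
  refine norm_sum_smul_le hb hb' hη fun t => ?_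
  split_ifs with ht
  · exact hf _ _ (by simpa [E] using ht)
  · simpa using hη

end UnitaryMatching

section Cuntz

variable {A : Type*} [CStarAlgebra A]

lemma cuntzLE_iff {a b : A} :
    CuntzLE a b ↔ ∀ ε : ℝ, 0 < ε → ∃ r, ‖star r * b * r - a‖ < ε := by
  constructor
  · rintro ⟨r, hr⟩ ε hε
    obtain ⟨n, hn⟩ := (hr.eventually (gt_mem_nhds hε)).exists
    exact ⟨r n, hn⟩
  · intro h
    choose r hr using fun n : ℕ => h (1 / (n + 1)) Nat.one_div_pos_of_nat
    exact ⟨r, squeeze_zero (fun _ => norm_nonneg _) (fun n => (hr n).le)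
      tendsto_one_div_add_atTop_nhds_zero_nat⟩

lemma CuntzLE.of_eq {a b : A} (r : A) (h : star r * b * r = a) : CuntzLE a b :=
  cuntzLE_iff.2 fun ε hε => ⟨r, by simpa [h] using hε⟩

lemma CuntzLE.of_approx {a b : A} (h : ∀ ε : ℝ, 0 < ε → ∃ a', ‖a' - a‖ < ε ∧ CuntzLE a' b) :
    CuntzLE a b := by
  refine cuntzLE_iff.2 fun ε hε => ?_
  obtain ⟨a', ha, hb⟩ := h (ε / 2) (half_pos hε)
  obtain ⟨r, hr⟩ := cuntzLE_iff.1 hb (ε / 2) (half_pos hε)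
  refine ⟨r, ?_⟩
  calc ‖star r * b * r - a‖ ≤ ‖star r * b * r - a'‖ + ‖a' - a‖ :=
        norm_sub_le_norm_sub_add_norm_sub ..
    _ < ε := by linarith

lemma CuntzLE.trans {a b c : A} (hab : CuntzLE a b) (hbc : CuntzLE b c) : CuntzLE a c := by
  refine CuntzLE.of_approx fun ε hε => ?_
  obtain ⟨r, hr⟩ := cuntzLE_iff.1 hab ε hε
  refine ⟨_, hr, cuntzLE_iff.2 fun ε hε => ?_⟩
  obtain ⟨s, hs⟩ := cuntzLE_iff.1 hbc (ε / (‖r‖ * ‖r‖ + 1)) (by positivity)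
  refine ⟨s * r, ?_⟩
  have e : star (s * r) * c * (s * r) - star r * b * r = star r * (star s * c * s - b) * r := by
    rw [star_mul]
    noncomm_ring
  rw [lt_div_iff₀ (by positivity)] at hs
  rw [e]
  calc ‖star r * (star s * c * s - b) * r‖
      ≤ ‖star r‖ * ‖star s * c * s - b‖ * ‖r‖ := norm_mul₃_le
    _ = ‖star s * c * s - b‖ * (‖r‖ * ‖r‖) := by rw [norm_star]; ring
    _ ≤ ‖star s * c * s - b‖ * (‖r‖ * ‖r‖ + 1) := by gcongr; linarith
    _ < ε := hs

/-- The image of a smaller function is Cuntz below the image of a larger one. -/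
lemma CuntzLE.map_of_le {Ω : Set ℂ} (hΩ : IsCompact Ω) (φ : C(Ω, ℂ) →⋆ₐ[ℂ] A) {f g : C(Ω, ℂ)}
    (h : ∀ x, ∃ s t : ℝ, 0 ≤ s ∧ s ≤ t ∧ f x = s ∧ g x = t) : CuntzLE (φ f) (φ g) := by
  have : CompactSpace Ω := isCompact_iff_compactSpace.1 hΩ
  refine cuntzLE_iff.2 fun ε hε => ?_
  obtain ⟨δ, hδ, hδε⟩ := exists_between hε
  have hpos : ∀ x, 0 < (g x).re + δ := fun x => by
    obtain ⟨s, t, hs, hst, -, h2⟩ := h x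
    rw [h2, Complex.ofReal_re]
    linarith
  let k : C(Ω, ℂ) := ⟨fun x => ((√((f x).re / ((g x).re + δ)) : ℝ) : ℂ), by
    refine Complex.continuous_ofReal.comp (Real.continuous_sqrt.comp (Continuous.div ?_ ?_ ?_))
    · fun_prop
    · fun_prop
    · exact fun x => (hpos x).ne'⟩
  refine ⟨φ k, lt_of_le_of_lt ?_ hδε⟩
  rw [← map_star, ← map_mul, ← map_mul, ← map_sub]
  refine (NonUnitalStarAlgHom.norm_apply_le φ _).trans ?_
  refine (ContinuousMap.norm_le _ hδ.le).2 fun x => ?_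
  obtain ⟨s, t, hs, hst, h1, h2⟩ := h x
  have hp := hpos x
  rw [h2, Complex.ofReal_re] at hp
  have e : (star k * g * k - f) x = ((-(s * (δ / (t + δ))) : ℝ) : ℂ) := by
    have hk : k x = ((√(s / (t + δ)) : ℝ) : ℂ) := by
      simp [k, h1, h2]
    simp only [ContinuousMap.sub_apply, ContinuousMap.mul_apply, ContinuousMap.star_apply, hk, h1,
      h2, RCLike.star_def, Complex.conj_ofReal]
    norm_cast
    have hq : √(s / (t + δ)) * √(s / (t + δ)) = s / (t + δ) :=
      Real.mul_self_sqrt (div_nonneg hs hp.le)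
    calc √(s / (t + δ)) * t * √(s / (t + δ)) - s
        = √(s / (t + δ)) * √(s / (t + δ)) * t - s := by ring
      _ = _ := by rw [hq]; field_simp; ring
  rw [e, Complex.norm_real, norm_neg, Real.norm_of_nonneg (by positivity), ← mul_div_assoc,
    div_le_iff₀ hp]
  nlinarith

/-- A version of the lemma of Rørdam: a positive element `b` close to `φ g` Cuntz dominates `φ f` when
`g` is bounded below on the support of `f`. -/
lemma CuntzLE.of_norm_sub_lt {Ω : Set ℂ} (hΩ : IsCompact Ω) {φ : C(Ω, ℂ) →⋆ₐ[ℂ] A}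
    (hφ : ∃ V : Submodule ℂ A, FiniteDimensional ℂ V ∧ Set.range φ ⊆ (V : Set A))
    {f g : C(Ω, ℂ)} {δ : ℝ} (hδ : 0 < δ) (hf : ∀ x, ∃ t : ℝ, 0 ≤ t ∧ f x = t)
    (hg : ∀ x, ∃ t : ℝ, g x = t ∧ (f x ≠ 0 → δ ≤ t)) {c : A}
    (hb : ‖φ g - star c * c‖ < δ) : CuntzLE (φ f) (star c * c) := by
  classical
  let := CStarAlgebra.spectralOrder A
  have := CStarAlgebra.spectralOrderedRing A
  obtain ⟨I, _, _, x, p, hp, hp', hp1, hφp⟩ := exists_projections_of_finiteDimensional_range hΩ φ hφ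
  choose s hs hfs using hf
  choose t hgt ht using hg
  set b := star c * c with hbdef
  let D : (I → ℂ) → A := fun l => ∑ i, l i • p i
  have hD : ∀ l m, D l * D m = D (l * m) := fun l m => by
    simp only [D, Finset.sum_mul]
    refine Finset.sum_congr rfl fun i _ => ?_
    rw [Finset.mul_sum, Finset.sum_eq_single i]
    · rw [smul_mul_smul_comm, (hp i).isIdempotentElem, Pi.mul_apply]
    · intro k _ hk
      rw [smul_mul_smul_comm, hp' _ _ hk.symm, smul_zero]
    · simp
  have hDs : ∀ l : I → ℝ, IsSelfAdjoint (D fun i => (l i : ℂ)) := fun l => by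
    simp [D, IsSelfAdjoint, star_sum, star_smul, (hp _).isSelfAdjoint.star_eq]
  let χ : I → ℝ := fun i => if s (x i) = 0 then 0 else 1
  let w : A := D fun i => ((χ i * (√(t (x i)))⁻¹ : ℝ) : ℂ)
  let P : A := D fun i => (χ i : ℂ)
  let d : A := D fun i => ((√(s (x i)) : ℝ) : ℂ)
  have hw : star w = w := hDs _
  have hPs : star P = P := hDs _
  have hd : star d = d := hDs _
  have hχ : ∀ i, χ i * χ i = χ i := fun i => by simp only [χ]; split_ifs <;> simp
  have hPP : P * P = P := by
    simp only [P, hD]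
    congr 1
    ext i
    simp only [Pi.mul_apply]
    norm_cast
    exact hχ i
  have hP : IsStarProjection P := ⟨hPP, hPs⟩
  have hwP : w * P = w := by
    simp only [P, w, hD]
    congr 1
    ext i
    simp only [Pi.mul_apply]
    norm_cast
    rw [mul_right_comm, hχ]
  have hPw : P * w = w := by
    simpa [hw, hPs] using congrArg star hwP
  have hst : ∀ i, s (x i) ≠ 0 → δ ≤ t (x i) := fun i hi =>
    ht _ (by rw [hfs]; exact_mod_cast hi)
  have hwgw : w * φ g * w = P := by
    rw [hφp g]
    change D _ * D (fun i => g (x i)) * D _ = D _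
    rw [hD, hD]
    congr 1
    ext i
    simp only [Pi.mul_apply, hgt]
    norm_cast
    by_cases hi : s (x i) = 0
    · simp [χ, hi]
    · have h0 : 0 < t (x i) := hδ.trans_le (hst i hi)
      have h1 : √(t (x i)) ≠ 0 := (Real.sqrt_pos.2 h0).ne'
      simp only [χ, if_neg hi, one_mul]
      nth_rewrite 2 [← Real.mul_self_sqrt h0.le]
      field_simp
  have hwn : ‖w‖ * ‖w‖ ≤ δ⁻¹ := by
    have h1 : ‖w‖ ≤ √(δ⁻¹) := by
      refine norm_sum_smul_le hp hp' (Real.sqrt_nonneg _) fun i => ?_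
      rw [Complex.norm_real, Real.norm_of_nonneg]
      · by_cases hi : s (x i) = 0
        · simp [χ, hi]
        · simp only [χ, if_neg hi, one_mul, Real.sqrt_inv]
          gcongr
          exact hst i hi
      · simp only [χ]; split_ifs <;> positivity
    calc ‖w‖ * ‖w‖ ≤ √(δ⁻¹) * √(δ⁻¹) := by gcongr
      _ = δ⁻¹ := Real.mul_self_sqrt (inv_nonneg.2 hδ.le)
  set h := w * b * w + (1 - P) with hh
  have hpos : 0 ≤ h := by
    refine add_nonneg ?_ hP.one_sub.nonneg
    have := star_left_conjugate_nonneg (star_mul_self_nonneg c) w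
    rwa [hw] at this
  have hunit : IsUnit h := by
    have e : h = 1 - w * (φ g - b) * w := by
      rw [mul_sub, sub_mul, hwgw, hh]
      abel
    rw [e]
    refine isUnit_one_sub_of_norm_lt_one ?_
    calc ‖w * (φ g - b) * w‖ ≤ ‖w‖ * ‖φ g - b‖ * ‖w‖ := norm_mul₃_le
      _ = ‖w‖ * ‖w‖ * ‖φ g - b‖ := by ring
      _ ≤ δ⁻¹ * ‖φ g - b‖ := by gcongr
      _ < δ⁻¹ * δ := by gcongr
      _ = 1 := inv_mul_cancel₀ hδ.ne'
  obtain ⟨k, hk, hkh, -, hkc⟩ := exists_inv_sqrt (IsStrictlyPositive.iff_of_unital.2 ⟨hpos, hunit⟩)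
  have hkP : k * P = P * k := by
    refine hkc P ?_
    rw [hh, Commute, SemiconjBy]
    simp only [add_mul, mul_add, sub_mul, mul_sub, hPP, mul_assoc, hwP]
    simp only [← mul_assoc, hPw, mul_one, one_mul]
  have hdPd : d * P * d = φ f := by
    rw [hφp f]
    change D _ * D _ * D _ = D _
    rw [hD, hD]
    congr 1
    ext i
    simp only [Pi.mul_apply, hfs]
    norm_cast
    by_cases hi : s (x i) = 0
    · simp [hi]
    · simp [χ, hi, Real.mul_self_sqrt (hs _)]
  refine CuntzLE.of_eq (w * k * P * d) ?_
  have e1 : w * b * w = h - (1 - P) := by rw [hh]; abel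
  have e2 : P * (k * (1 - P) * k) * P = 0 := by
    calc P * (k * (1 - P) * k) * P = (k * P) * (1 - P) * k * P := by rw [hkP]; simp only [mul_assoc]
      _ = k * (P * (1 - P)) * k * P := by simp only [mul_assoc]
      _ = 0 := by rw [mul_sub, hPP, mul_one, sub_self]; simp
  calc star (w * k * P * d) * b * (w * k * P * d)
      = d * (P * (k * (w * b * w) * k) * P) * d := by
        simp only [star_mul, hw, hk.star_eq, hPs, hd, mul_assoc]
    _ = d * (P * (k * h * k) * P - P * (k * (1 - P) * k) * P) * d := by
        rw [e1]; noncomm_ring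
    _ = d * P * d := by rw [e2, hkh, mul_one, hPP, sub_zero]
    _ = φ f := hdPd

end Cuntz

section CuntzDistance

variable {A : Type*} [CStarAlgebra A] {Ω : Set ℂ}

lemma exists_fO_eq_star_mul_self (Ω O : Set ℂ) : ∃ g : C(Ω, ℂ), fO Ω O = star g * g := by
  refine ⟨⟨fun x => ((√(fO Ω O x).re : ℝ) : ℂ), Complex.continuous_ofReal.comp
    (Real.continuous_sqrt.comp (Complex.continuous_re.comp (fO Ω O).continuous))⟩, ?_⟩
  ext x
  obtain ⟨t, h0, -, ht⟩ := fO_apply_eq (O := O) x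
  simp only [ContinuousMap.mul_apply, ContinuousMap.star_apply, ContinuousMap.coe_mk, ht,
    Complex.ofReal_re, RCLike.star_def, Complex.conj_ofReal]
  norm_cast
  exact (Real.mul_self_sqrt h0).symm

lemma CuntzLE.map_fO_of_subset (hΩ : IsCompact Ω) (φ : C(Ω, ℂ) →⋆ₐ[ℂ] A) {O O' : Set ℂ}
    (h : O ⊆ O') : CuntzLE (φ (fO Ω O)) (φ (fO Ω O')) := by
  refine CuntzLE.map_of_le hΩ φ fun x => ⟨_, _, ENNReal.toReal_nonneg, ?_, rfl, rfl⟩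
  refine ENNReal.toReal_mono (ne_top_of_le_ne_top ENNReal.one_ne_top (min_le_left _ _)) ?_
  exact min_le_min le_rfl (Metric.infEDist_anti (Set.sdiff_subset_sdiff_right h))

lemma thicken_mono (Ω O : Set ℂ) {r s : ℝ} (h : r ≤ s) : thicken Ω O r ⊆ thicken Ω O s :=
  fun _ hx => ⟨hx.1, hx.2.trans_le h⟩

lemma exists_of_dW_lt {φ ψ : C(Ω, ℂ) → A} {ε : ℝ} (h : dW Ω φ ψ < ENNReal.ofReal ε) :
    ∃ r < ε, ∀ O, RelOpen Ω O → CuntzLE (φ (fO Ω O)) (ψ (fO Ω (thicken Ω O r))) ∧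
      CuntzLE (ψ (fO Ω O)) (φ (fO Ω (thicken Ω O r))) := by
  obtain ⟨_, ⟨r, hr, rfl, hO⟩, hrε⟩ := sInf_lt_iff.1 h
  exact ⟨r, (ENNReal.ofReal_lt_ofReal_iff'.1 hrε).1, hO⟩

lemma CuntzLE.of_dW_lt (hΩ : IsCompact Ω) {φ ψ : C(Ω, ℂ) →⋆ₐ[ℂ] A} {ε : ℝ}
    (h : dW Ω φ ψ < ENNReal.ofReal ε) {O : Set ℂ} (hO : RelOpen Ω O) :
    CuntzLE (φ (fO Ω O)) (ψ (fO Ω (thicken Ω O ε))) := by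
  obtain ⟨r, hr, h⟩ := exists_of_dW_lt h
  exact (h O hO).1.trans (CuntzLE.map_fO_of_subset hΩ ψ (thicken_mono Ω O hr.le))

/-- `f_{O_R}` is bounded below on `O_s` for `s < R`. -/
lemma le_fO_thicken {O : Set ℂ} {s R : ℝ} (x : Ω) (hx : (x : ℂ) ∈ thicken Ω O s) :
    ∃ t : ℝ, fO Ω (thicken Ω O R) x = t ∧ min 1 (R - s) ≤ t := by
  refine ⟨_, rfl, ?_⟩
  refine (ENNReal.ofReal_le_iff_le_toReal
    (ne_top_of_le_ne_top ENNReal.one_ne_top (min_le_left _ _))).1 ?_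
  rw [ENNReal.ofReal_min, ENNReal.ofReal_one]
  refine min_le_min le_rfl (Metric.le_infEDist.2 fun y hy => ?_)
  rw [edist_dist]
  refine ENNReal.ofReal_le_ofReal ?_
  have h1 : R ≤ Metric.infDist y O := not_lt.1 fun h => hy.2 ⟨hy.1, h⟩
  have h2 := Metric.infDist_le_infDist_add_dist (s := O) (x := y) (y := (x : ℂ))
  have h3 := hx.2
  rw [dist_comm] at h2
  linarith

/-- A sequence of `*`-homomorphisms which converges on the coordinate function converges
pointwise to a `*`-homomorphism. -/
lemma exists_limit_starAlgHom (hΩ : IsCompact Ω) (Ψ : ℕ → C(Ω, ℂ) →⋆ₐ[ℂ] A)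
    (h : CauchySeq fun n => Ψ n (.restrict Ω <| .id ℂ)) :
    ∃ Φ : C(Ω, ℂ) →⋆ₐ[ℂ] A, ∀ f, Tendsto (fun n => Ψ n f) atTop (nhds (Φ f)) := by
  have : CompactSpace Ω := isCompact_iff_compactSpace.1 hΩ
  obtain ⟨a, ha⟩ := cauchySeq_tendsto_of_complete h
  have hlim : ∀ f, ∃ l, Tendsto (fun n => Ψ n f) atTop (nhds l) := by
    intro f
    induction f using ContinuousMap.induction_on_of_compact with
    | const r =>
      refine ⟨algebraMap ℂ A r, ?_⟩
      have : ∀ n, Ψ n (.const Ω r) = algebraMap ℂ A r := fun n => AlgHomClass.commutes (Ψ n) r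
      simp only [this]
      exact tendsto_const_nhds
    | id => exact ⟨a, ha⟩
    | star_id => exact ⟨star a, by simpa only [map_star] using ha.star⟩
    | add f g hf hg =>
      obtain ⟨l, hl⟩ := hf
      obtain ⟨m, hm⟩ := hg
      exact ⟨l + m, by simpa only [map_add] using hl.add hm⟩
    | mul f g hf hg =>
      obtain ⟨l, hl⟩ := hf
      obtain ⟨m, hm⟩ := hg
      exact ⟨l * m, by simpa only [map_mul] using hl.mul hm⟩
    | frequently f hf =>
      refine cauchySeq_tendsto_of_complete (Metric.cauchySeq_iff'.2 fun ε hε => ?_)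
      obtain ⟨g, ⟨l, hl⟩, hg⟩ := (hf.and_eventually (Metric.ball_mem_nhds f
        (show 0 < ε / 3 by positivity))).exists
      obtain ⟨N, hN⟩ := Metric.cauchySeq_iff'.1 hl.cauchySeq (ε / 3) (by positivity)
      refine ⟨N, fun n hn => ?_⟩
      have h1 : ∀ k, dist (Ψ k g) (Ψ k f) < ε / 3 := fun k => by
        rw [dist_eq_norm, ← map_sub]
        refine (NonUnitalStarAlgHom.norm_apply_le (Ψ k) _).trans_lt ?_
        rwa [← dist_eq_norm]
      have h2 := dist_triangle4 (Ψ n f) (Ψ n g) (Ψ N g) (Ψ N f)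
      have h3 := h1 n
      rw [dist_comm] at h3
      linarith [h1 N, hN n hn]
  choose L hL using hlim
  refine ⟨⟨⟨⟨⟨⟨L, ?_⟩, ?_⟩, ?_, ?_⟩, ?_⟩, ?_⟩, hL⟩
  · exact tendsto_nhds_unique (hL 1) (by simp only [map_one]; exact tendsto_const_nhds)
  · exact fun f g => tendsto_nhds_unique (hL _)
      (by simpa only [map_mul] using (hL f).mul (hL g))
  · exact tendsto_nhds_unique (hL 0) (by simp only [map_zero]; exact tendsto_const_nhds)
  · exact fun f g => tendsto_nhds_unique (hL _)
      (by simpa only [map_add] using (hL f).add (hL g))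
  · exact fun r => tendsto_nhds_unique (hL _)
      (by simp only [AlgHomClass.commutes]; exact tendsto_const_nhds)
  · exact fun f => tendsto_nhds_unique (hL _) (by simpa only [map_star] using (hL f).star)

/-- A sequence in which consecutive `*`-homomorphisms are summably close in `d_W` converges
pointwise, after conjugation by suitable unitaries. -/
lemma exists_unitary_conj_tendsto (hsr1 : Dense {a : A | IsUnit a})
    (hrr0 : ∀ a : A, IsSelfAdjoint a → a ∈ closure {b : A | IsSelfAdjoint b ∧ IsUnit b})
    (hΩ : IsCompact Ω) (φ : ℕ → (C(Ω, ℂ) →⋆ₐ[ℂ] A))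
    (hfd : ∀ n, ∃ V : Submodule ℂ A, FiniteDimensional ℂ V ∧ Set.range (φ n) ⊆ (V : Set A))
    (hC : ∀ n, dW Ω (φ n) (φ (n + 1)) < ENNReal.ofReal ((1 / 2) ^ n)) :
    ∃ (W : ℕ → unitary A) (Φ : C(Ω, ℂ) →⋆ₐ[ℂ] A),
      ∀ f, Tendsto (fun n => (W n : A) * φ n f * star (W n : A)) atTop (nhds (Φ f)) := by
  have hU : ∀ n, ∃ U : unitary A, ∀ (f : C(Ω, ℂ)) (η : ℝ), 0 ≤ η →
      (∀ x y : Ω, dist x y < (1 / 2) ^ n → ‖f x - f y‖ ≤ η) →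
      ‖(U : A) * φ n f * star (U : A) - φ (n + 1) f‖ ≤ η := by
    intro n
    obtain ⟨r, hr, h⟩ := exists_of_dW_lt (hC n)
    obtain ⟨U, hU, h⟩ := exists_unitary_of_cuntzLE hsr1 hrr0 hΩ (hfd n) (hfd (n + 1)) hr
      fun O hO => (h O hO).1
    exact ⟨⟨U, hU⟩, h⟩
  choose U hU using hU
  obtain ⟨W, hW⟩ : ∃ W : ℕ → unitary A, ∀ n, W (n + 1) = W n * star (U n) :=
    ⟨fun n => Nat.rec 1 (fun k w => w * star (U k)) n, fun _ => rfl⟩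
  let Ψ : ℕ → C(Ω, ℂ) →⋆ₐ[ℂ] A := fun n =>
    ((Unitary.conjStarAlgAut ℂ A (W n) : A ≃⋆ₐ[ℂ] A) : A →⋆ₐ[ℂ] A).comp (φ n)
  have hΨ : ∀ (n : ℕ) (f : C(Ω, ℂ)), Ψ n f = (W n : A) * φ n f * star (W n : A) := by
    intro n f
    rfl
  obtain ⟨Φ, hΦ⟩ := exists_limit_starAlgHom hΩ Ψ (by
    refine cauchySeq_of_le_geometric (1 / 2) 1 (by norm_num) fun n => ?_
    set f : C(Ω, ℂ) := .restrict Ω <| .id ℂ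
    have h1 := hU n f ((1 / 2) ^ n) (by positivity) fun x y hxy => by
      rw [← dist_eq_norm]
      exact hxy.le
    have e : Ψ n f - Ψ (n + 1) f = (W n : A) * (star (U n : A) *
        ((U n : A) * φ n f * star (U n : A) - φ (n + 1) f) * (U n : A)) * star (W n : A) := by
      have e1 : star (U n : A) * (U n : A) = 1 := Unitary.coe_star_mul_self (U n)
      have e2 : star (U n : A) * ((U n : A) * φ n f * star (U n : A) - φ (n + 1) f) * (U n : A)
          = φ n f - star (U n : A) * φ (n + 1) f * (U n : A) := by
        rw [mul_sub, sub_mul]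
        congr 1
        calc star (U n : A) * ((U n : A) * φ n f * star (U n : A)) * (U n : A)
            = (star (U n : A) * (U n : A)) * φ n f * (star (U n : A) * (U n : A)) := by
              simp only [mul_assoc]
          _ = φ n f := by rw [e1, one_mul, mul_one]
      rw [e2, hΨ, hΨ, hW]
      simp only [Submonoid.coe_mul, Unitary.coe_star, star_mul, star_star, mul_sub, sub_mul,
        mul_assoc]
    have h2 : ∀ (u : unitary A) (a : A), ‖(u : A) * a * star (u : A)‖ = ‖a‖ := fun u a => by
      rw [← Unitary.coe_star, CStarRing.norm_mul_coe_unitary, CStarRing.norm_coe_unitary_mul]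
    have h3 := h2 (star (U n)) ((U n : A) * φ n f * star (U n : A) - φ (n + 1) f)
    rw [Unitary.coe_star, star_star] at h3
    rw [dist_eq_norm, e, one_mul, h2, h3]
    exact h1)
  exact ⟨W, Φ, hΦ⟩

end CuntzDistance

/-- Let `A` be a unital, simple, separable C*-algebra with stable rank one, real rank zero and
strict comparison, and let `Ω` be a compact subset of `ℂ`.  Let `(φₙ)` be a sequence of unital
*-homomorphisms `C(Ω, ℂ) → A` with finite-dimensional range which is Cauchy with respect to
`d_W`.  Then there is a unital *-homomorphism `φ : C(Ω, ℂ) → A` with `d_W(φₙ, φ) → 0`. -/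
theorem statement14 {A : Type*} [CStarAlgebra A] [TopologicalSpace.SeparableSpace A]
    (hsimple : ∀ I : TwoSidedIdeal A, IsClosed (I : Set A) → I = ⊥ ∨ I = ⊤)
    (hsr1 : Dense {a : A | IsUnit a})
    (hrr0 : ∀ a : A, IsSelfAdjoint a → a ∈ closure {b : A | IsSelfAdjoint b ∧ IsUnit b})
    (hsc : StrictComparison A)
    (Ω : Set ℂ) (hΩ : IsCompact Ω)
    (φ : ℕ → (C(Ω, ℂ) →⋆ₐ[ℂ] A))
    (hfd : ∀ n, ∃ V : Submodule ℂ A, FiniteDimensional ℂ V ∧ Set.range (φ n) ⊆ (V : Set A))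
    (hC : ∀ ε : ℝ, 0 < ε → ∃ N : ℕ, ∀ n ≥ N, ∀ m ≥ N,
      dW Ω ⇑(φ n) ⇑(φ m) < ENNReal.ofReal ε) :
    ∃ Φ : C(Ω, ℂ) →⋆ₐ[ℂ] A, Tendsto (fun n => dW Ω ⇑(φ n) ⇑Φ) atTop (nhds 0) := by
  have hN : ∀ n : ℕ, ∃ N : ℕ, ∀ k ≥ N, ∀ m ≥ N,
      dW Ω (φ k) (φ m) < ENNReal.ofReal ((1 / 2) ^ n) := fun n => hC _ (by positivity)
  choose N hN using hN
  let ν : ℕ → ℕ := fun n => n + (Finset.range (n + 1)).sup N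
  have hνN : ∀ n m, n ≤ m → N n ≤ ν m := fun n m h =>
    (Finset.le_sup (f := N) (Finset.mem_range.2 (Nat.lt_succ_of_le h))).trans (Nat.le_add_left _ _)
  have hνle : ∀ n, n ≤ ν n := fun n => Nat.le_add_right _ _
  obtain ⟨W, Φ, hΦ⟩ := exists_unitary_conj_tendsto hsr1 hrr0 hΩ (fun n => φ (ν n))
    (fun n => hfd (ν n)) fun n => hN n _ (hνN n n le_rfl) _ (hνN n (n + 1) n.le_succ)
  refine ⟨Φ, ENNReal.tendsto_nhds_zero.2 fun ε hε => ?_⟩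
  obtain ⟨R, hR0, hRε⟩ : ∃ R : ℝ, 0 < R ∧ ENNReal.ofReal R ≤ ε := by
    obtain ⟨R, -, hR, hRε⟩ := ENNReal.lt_iff_exists_real_btwn.1 hε
    exact ⟨R, ENNReal.ofReal_pos.1 hR, hRε.le⟩
  obtain ⟨M, hM⟩ := hC (R / 2) (half_pos hR0)
  filter_upwards [eventually_ge_atTop M] with n hn
  refine le_trans (sInf_le ⟨R, hR0, rfl, fun O hO => ?_⟩) hRε
  have hconj : ∀ k f, CuntzLE ((W k : A) * φ (ν k) f * star (W k : A)) (φ (ν k) f) := fun k f =>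
    CuntzLE.of_eq (star (W k : A)) (by rw [star_star])
  constructor
  · obtain ⟨g, hg⟩ := exists_fO_eq_star_mul_self Ω (thicken Ω O R)
    have hδ : 0 < min 1 (R - R / 2) := lt_min one_pos (by linarith)
    obtain ⟨k, hk, hkM⟩ := (((tendsto_iff_norm_sub_tendsto_zero.1
      (hΦ (fO Ω (thicken Ω O R)))).eventually (gt_mem_nhds hδ)).and (eventually_ge_atTop M)).exists
    have h1 := CuntzLE.of_dW_lt hΩ (hM n hn (ν k) (hkM.trans (hνle k))) hO
    refine h1.trans ?_
    let Ψ : C(Ω, ℂ) →⋆ₐ[ℂ] A :=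
      ((Unitary.conjStarAlgAut ℂ A (W k) : A ≃⋆ₐ[ℂ] A) : A →⋆ₐ[ℂ] A).comp (φ (ν k))
    have hΨ : ∀ f : C(Ω, ℂ), Ψ f = (W k : A) * φ (ν k) f * star (W k : A) := fun f => rfl
    have hΨfd : ∃ V : Submodule ℂ A, FiniteDimensional ℂ V ∧ Set.range Ψ ⊆ (V : Set A) := by
      obtain ⟨V, hV, hφV⟩ := hfd (ν k)
      refine ⟨V.map (Unitary.conjStarAlgAut ℂ A (W k)).toAlgEquiv.toLinearMap, inferInstance, ?_⟩
      rintro _ ⟨f, rfl⟩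
      exact ⟨φ (ν k) f, hφV ⟨f, rfl⟩, rfl⟩
    have h2 : CuntzLE (φ (ν k) (fO Ω (thicken Ω O (R / 2)))) (Ψ (fO Ω (thicken Ω O (R / 2)))) := by
      refine CuntzLE.of_eq (W k : A) ?_
      have e1 : star (W k : A) * (W k : A) = 1 := Unitary.coe_star_mul_self (W k)
      calc star (W k : A) * ((W k : A) * φ (ν k) (fO Ω (thicken Ω O (R / 2))) * star (W k : A))
            * (W k : A)
          = (star (W k : A) * (W k : A)) * φ (ν k) (fO Ω (thicken Ω O (R / 2)))
            * (star (W k : A) * (W k : A)) := by simp only [mul_assoc]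
        _ = _ := by rw [e1, one_mul, mul_one]
    refine h2.trans ?_
    have h3 : Φ (fO Ω (thicken Ω O R)) = star (Φ g) * Φ g := by rw [hg, map_mul, map_star]
    rw [h3]
    refine CuntzLE.of_norm_sub_lt hΩ hΨfd (g := fO Ω (thicken Ω O R)) hδ (fun x => ?_)
      (fun x => ?_) ?_
    · obtain ⟨t, ht, -, h⟩ := fO_apply_eq (O := thicken Ω O (R / 2)) x
      exact ⟨t, ht, h⟩
    · by_cases hx : (x : ℂ) ∈ thicken Ω O (R / 2)
      · obtain ⟨t, ht, h⟩ := le_fO_thicken (R := R) x hx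
        exact ⟨t, ht, fun _ => h⟩
      · obtain ⟨t, -, -, ht⟩ := fO_apply_eq (O := thicken Ω O R) x
        exact ⟨t, ht, fun h => absurd ((fO_apply_eq_zero_iff (relOpen_thicken Ω O _) x).2 hx) h⟩
    · rw [← h3]
      exact hk
  · refine CuntzLE.of_approx fun δ hδ => ?_
    obtain ⟨k, hk, hkM⟩ := (((tendsto_iff_norm_sub_tendsto_zero.1
      (hΦ (fO Ω O))).eventually (gt_mem_nhds hδ)).and (eventually_ge_atTop M)).exists
    refine ⟨_, hk, (hconj k _).trans ?_⟩
    have h1 := CuntzLE.of_dW_lt hΩ (hM (ν k) (hkM.trans (hνle k)) n hn) hO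
    exact h1.trans (CuntzLE.map_fO_of_subset hΩ (φ n) (thicken_mono Ω O (by linarith)))
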